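/- Every infinite 2-connected subcubic graph has a faithful spanning cactus. -/

import Mathlib

namespace IGraph

open SimpleGraph

universe u w

variable {V : Type u} {W : Type w}

/-- `G` is locally finite: every vertex has finite degree. -/
def LocFin (G : SimpleGraph V) : Prop := ∀ v : V, (G.neighborSet v).Finite

/-- A ray of `G`: a one-way infinite path, given by an injective sequence of
successively adjacent vertices. -/
def IsRay (G : SimpleGraph V) (R : ℕ → V) : Prop :=
  Function.Injective R ∧ ∀ n : ℕ, G.Adj (R n) (R (n + 1))

/-- `G − S`, kept on the same vertex type (removed vertices become isolated). -/
def del (G : SimpleGraph V) (S : Set V) : SimpleGraph V where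
  Adj a b := G.Adj a b ∧ a ∉ S ∧ b ∉ S
  symm := ⟨fun a b h => ⟨h.1.symm, h.2.2, h.2.1⟩⟩
  loopless := ⟨fun a h => G.loopless.irrefl a h.1⟩

/-- Two rays are equivalent in `G` if for every finite `S ⊆ V(G)` some component of
`G − S` contains a tail of both. -/
def RayEquiv (G : SimpleGraph V) (R₁ R₂ : ℕ → V) : Prop :=
  ∀ S : Set V, S.Finite →
    ∃ m n : ℕ, (∀ i, m ≤ i → R₁ i ∉ S) ∧ (∀ j, n ≤ j → R₂ j ∉ S) ∧
      (del G S).Reachable (R₁ m) (R₂ n)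

/-- `F` is a faithful subgraph of `G` (both presented on the same vertex type):
(1) every end of `G` contains a ray of `F`, and (2) two rays of `F` are equivalent in `F`
iff they are equivalent in `G`. -/
def Faithful (F G : SimpleGraph V) : Prop :=
  (∀ R : ℕ → V, IsRay G R → ∃ R' : ℕ → V, IsRay F R' ∧ RayEquiv G R R') ∧
  ∀ R₁ R₂ : ℕ → V, IsRay F R₁ → IsRay F R₂ → (RayEquiv F R₁ R₂ ↔ RayEquiv G R₁ R₂)

/-- `N_G(X)`: vertices outside `X` with a neighbor in `X`. -/
def NSet (G : SimpleGraph V) (X : Set V) : Set V := {y | y ∉ X ∧ ∃ x ∈ X, G.Adj x y}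

/-- `Z_G(X)`: vertices of `X` with a neighbor outside `X`. -/
def ZSet (G : SimpleGraph V) (X : Set V) : Set V := {x | x ∈ X ∧ ∃ y, y ∉ X ∧ G.Adj x y}

/-- The vertex set of the component of `G − S` containing `v`. -/
def compOf (G : SimpleGraph V) (S : Set V) (v : V) : Set V := {x | (del G S).Reachable v x}

/-- The degree of the end of `G` represented by the ray `R`: the supremum of the numbers of
pairwise vertex-disjoint rays equivalent to `R`. -/
noncomputable def endDegree (G : SimpleGraph V) (R : ℕ → V) : ℕ∞ :=
  ⨆ n ∈ {n : ℕ | ∃ f : Fin n → ℕ → V,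
      (∀ i, IsRay G (f i) ∧ RayEquiv G (f i) R) ∧
      ∀ i j, i ≠ j → Disjoint (Set.range (f i)) (Set.range (f j))}, (n : ℕ∞)

/-- `H` is `k`-connected: `|V(H)| > k` and removing fewer than `k` vertices leaves a
connected graph. -/
def IsKConn (k : ℕ) (H : SimpleGraph W) : Prop :=
  (k : Cardinal) < Cardinal.mk W ∧
    ∀ X : Set W, X.Finite → X.ncard < k → (H.induce Xᶜ).Connected

/-- Every vertex has degree at most 3. -/
def Subcubic (G : SimpleGraph V) : Prop :=
  ∀ v : V, (G.neighborSet v).Finite ∧ (G.neighborSet v).ncard ≤ 3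

/-- Every vertex has degree exactly 3. -/
def Cubic (G : SimpleGraph V) : Prop := ∀ v : V, (G.neighborSet v).ncard = 3

/-- `S` is 3-connected in `G`: every two vertices of `S` are joined by three pairwise
internally disjoint paths of `G`. -/
def ThreeConnIn (G : SimpleGraph V) (S : Set V) : Prop :=
  ∀ u v : V, u ∈ S → v ∈ S → u ≠ v →
    ∃ p₁ p₂ p₃ : G.Path u v,
      p₁ ≠ p₂ ∧ p₁ ≠ p₃ ∧ p₂ ≠ p₃ ∧
      (∀ x, x ∈ (p₁ : G.Walk u v).support → x ∈ (p₂ : G.Walk u v).support → x = u ∨ x = v) ∧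
      (∀ x, x ∈ (p₁ : G.Walk u v).support → x ∈ (p₃ : G.Walk u v).support → x = u ∨ x = v) ∧
      (∀ x, x ∈ (p₂ : G.Walk u v).support → x ∈ (p₃ : G.Walk u v).support → x = u ∨ x = v)

/-- A subgraph which is a (finite) cycle: finite, nonempty, connected and 2-regular. -/
def IsCycleSub {G : SimpleGraph W} (C : G.Subgraph) : Prop :=
  C.verts.Finite ∧ C.verts.Nonempty ∧ C.Connected ∧
    ∀ v ∈ C.verts, (C.neighborSet v).ncard = 2

/-- A cactus: a connected subcubic graph whose cycles are pairwise vertex-disjoint and whose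
edges decompose into vertex-disjoint cycles and vertex-disjoint paths (equivalently, every
vertex on no cycle has degree at most 2). -/
def IsCactus (H : SimpleGraph W) : Prop :=
  H.Connected ∧ Subcubic H ∧
  (∀ C₁ C₂ : H.Subgraph, IsCycleSub C₁ → IsCycleSub C₂ → C₁ ≠ C₂ →
    Disjoint C₁.verts C₂.verts) ∧
  ∀ v : W, (∀ C : H.Subgraph, IsCycleSub C → v ∉ C.verts) → (H.neighborSet v).ncard ≤ 2

/-- A semi-cactus: connected, maximum degree at most 4, every block is a cycle or a `K₂`
(equivalently, distinct cycles are edge-disjoint), and every vertex lies in at most two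
blocks (cycles through `v` together with bridges at `v` number at most 2). -/
def IsSemiCactus (H : SimpleGraph W) : Prop :=
  H.Connected ∧ (∀ v : W, (H.neighborSet v).Finite ∧ (H.neighborSet v).ncard ≤ 4) ∧
  (∀ C₁ C₂ : H.Subgraph, IsCycleSub C₁ → IsCycleSub C₂ → C₁ ≠ C₂ →
    Disjoint C₁.edgeSet C₂.edgeSet) ∧
  ∀ v : W,
    {C : H.Subgraph | IsCycleSub C ∧ v ∈ C.verts}.encard +
      {e : Sym2 W | e ∈ H.edgeSet ∧ v ∈ e ∧
        ∀ C : H.Subgraph, IsCycleSub C → e ∉ C.edgeSet}.encard ≤ 2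

/-- Every cycle of `H` is even. -/
def EvenCycles (H : SimpleGraph W) : Prop :=
  ∀ C : H.Subgraph, IsCycleSub C → Even C.verts.ncard

/-- `v` is a cut-vertex of `H`: removing `v` separates two vertices. -/
def IsCutVert (H : SimpleGraph W) (v : W) : Prop :=
  ∃ a b : W, a ≠ v ∧ b ≠ v ∧ H.Reachable a b ∧ ¬ (del H {v}).Reachable a b

/-- `H` is non-separable: connected without cut-vertices. -/
def Nonseparable (H : SimpleGraph W) : Prop := H.Connected ∧ ∀ v : W, ¬ IsCutVert H v

/-- `B` is the vertex set of a block of `H`: a maximal set inducing a non-separable graph. -/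
def IsBlockSet (H : SimpleGraph W) (B : Set W) : Prop :=
  Nonseparable (H.induce B) ∧ ∀ B' : Set W, B ⊆ B' → Nonseparable (H.induce B') → B' = B

/-- An end-block: a block containing at most one cut-vertex of `H`. -/
def IsEndBlock (H : SimpleGraph W) (B : Set W) : Prop :=
  IsBlockSet H B ∧ {v ∈ B | IsCutVert H v}.encard ≤ 1

/-- A block-chain: a connected graph whose block-cut tree is a path, i.e. every block
contains at most two cut-vertices and every cut-vertex lies in at most two blocks. -/
def IsBlockChain (H : SimpleGraph W) : Prop :=
  H.Connected ∧
  (∀ B : Set W, IsBlockSet H B → {v ∈ B | IsCutVert H v}.encard ≤ 2) ∧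
  ∀ v : W, IsCutVert H v → {B : Set W | IsBlockSet H B ∧ v ∈ B}.encard ≤ 2

/-- A block-chain connecting `u` and `v`: either `H` is non-separable, or `H` is separable
and `u`, `v` are non-cut vertices of two distinct end-blocks. -/
def BlockChainConn (H : SimpleGraph W) (u v : W) : Prop :=
  IsBlockChain H ∧
  (Nonseparable H ∨
    ((∃ x, IsCutVert H x) ∧
      ∃ B₁ B₂ : Set W, IsEndBlock H B₁ ∧ IsEndBlock H B₂ ∧ B₁ ≠ B₂ ∧
        u ∈ B₁ ∧ v ∈ B₂ ∧ ¬ IsCutVert H u ∧ ¬ IsCutVert H v))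

/-- The `k`-th power of `G`: vertices at distance at most `k` become adjacent. -/
def gpow (G : SimpleGraph V) (k : ℕ) : SimpleGraph V where
  Adj u v := u ≠ v ∧ ∃ p : G.Walk u v, p.length ≤ k
  symm := ⟨fun u v h => ⟨h.1.symm, by obtain ⟨p, hp⟩ := h.2; exact ⟨p.reverse, by simpa using hp⟩⟩⟩
  loopless := ⟨fun v h => h.1 rfl⟩

/-- The copy `G × {d₀}` of `G` inside the Cartesian product `G □ D`. -/
def copyAt (G : SimpleGraph V) (d₀ : W) : SimpleGraph (V × W) where
  Adj p q := G.Adj p.1 q.1 ∧ p.2 = d₀ ∧ q.2 = d₀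
  symm := ⟨fun p q h => ⟨h.1.symm, h.2.2, h.2.1⟩⟩
  loopless := ⟨fun p h => G.loopless.irrefl _ h.1⟩

/-- The line graph of the subgraph `F` of `G`, presented on the vertex set `E(G)` of the
line graph of `G` (edges of `G` not in `F` are isolated). -/
def lineSub (G F : SimpleGraph V) : SimpleGraph G.edgeSet where
  Adj e f := (e : Sym2 V) ∈ F.edgeSet ∧ (f : Sym2 V) ∈ F.edgeSet ∧ e ≠ f ∧
    ∃ x : V, x ∈ (e : Sym2 V) ∧ x ∈ (f : Sym2 V)
  symm := ⟨fun e f h =>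
    ⟨h.2.1, h.1, h.2.2.1.symm, by obtain ⟨x, h1, h2⟩ := h.2.2.2; exact ⟨x, h2, h1⟩⟩⟩
  loopless := ⟨fun e h => h.2.2.1 rfl⟩

/-- `B ⊆ V(G)` induces a cycle of `G`. -/
def IsCycleSet (G : SimpleGraph V) (B : Set V) : Prop :=
  B.Finite ∧ B.Nonempty ∧ (G.induce B).Connected ∧
    ∀ v ∈ B, (G.neighborSet v ∩ B).ncard = 2

/-- The spanning subgraph of `G` whose edges are those of `G[B]`. -/
def restr (G : SimpleGraph V) (B : Set V) : SimpleGraph V where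
  Adj a b := G.Adj a b ∧ a ∈ B ∧ b ∈ B
  symm := ⟨fun _ _ h => ⟨h.1.symm, h.2.2, h.2.1⟩⟩
  loopless := ⟨fun a h => G.loopless.irrefl a h.1⟩

lemma reachable_induction {H : SimpleGraph V} {a b : V} (h : H.Reachable a b) (P : V → Prop)
    (ha : P a) (hs : ∀ x y, H.Adj x y → P x → P y) : P b := by
  obtain ⟨p⟩ := h
  induction p with
  | nil => exact ha
  | cons hadj _ ih => exact ih (hs _ _ hadj ha)

lemma exists_adj_leaving {H : SimpleGraph V} {a b : V} (h : H.Reachable a b) {S : Set V}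
    (ha : a ∈ S) (hb : b ∉ S) : ∃ x y, H.Adj x y ∧ x ∈ S ∧ y ∉ S := by
  by_contra! hc
  exact hb (reachable_induction h (· ∈ S) ha fun x y hxy hx => hc x y hxy hx)

lemma reachable_restr {N H : SimpleGraph V} {B : Set V} (hNH : N ≤ H)
    (hB : ∀ x y, N.Adj x y → x ∈ B → y ∈ B) {a b : V} (ha : a ∈ B) (h : N.Reachable a b) :
    (restr H B).Reachable a b := by
  have := reachable_induction h (fun x => x ∈ B ∧ (restr H B).Reachable a x) ⟨ha, .rfl⟩ ?_
  · exact this.2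
  · intro x y hxy hx
    have hy := hB x y hxy hx.1
    exact ⟨hy, hx.2.trans (SimpleGraph.Adj.reachable ⟨hNH hxy, hx.1, hy⟩)⟩

lemma not_mem_of_reachable_del {H : SimpleGraph V} {S : Set V} {a b : V} (ha : a ∉ S)
    (h : (del H S).Reachable a b) : b ∉ S :=
  reachable_induction h (· ∉ S) ha fun _ _ hxy _ => hxy.2.2

/-- A shortest walk from `y` to a set `O` avoiding `x` is a path meeting `O` only at its end. -/
lemma exists_path_to_set {H : SimpleGraph V} {O : Set V} {x y o : V} (hyx : y ≠ x) (ho : o ∈ O)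
    (h : (del H {x}).Reachable y o) :
    ∃ z ∈ O, ∃ s : H.Walk y z, s.IsPath ∧ x ∉ s.support ∧ ∀ t ∈ s.support, t ∈ O → t = z := by
  classical
  have hex : ∃ n, ∃ z ∈ O, ∃ s : (del H {x}).Walk y z, s.length = n := by
    obtain ⟨s⟩ := h
    exact ⟨_, o, ho, s, rfl⟩
  obtain ⟨z, hz, s, hs⟩ := Nat.find_spec hex
  have hmin : ∀ z' ∈ O, ∀ s' : (del H {x}).Walk y z', s.length ≤ s'.length := by
    intro z' hz' s'
    rw [hs]
    exact Nat.find_min' hex ⟨z', hz', s', rfl⟩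
  have hle : del H {x} ≤ H := fun _ _ h => h.1
  refine ⟨z, hz, s.bypass.mapLe hle, ?_, ?_, ?_⟩
  · exact (SimpleGraph.Walk.isPath_mapLe hle).2 s.bypass_isPath
  · rw [SimpleGraph.Walk.support_mapLe_eq_support]
    intro hx
    exact not_mem_of_reachable_del (by simpa using hyx)
      (s.bypass.takeUntil x hx).reachable rfl
  · intro t ht htO
    rw [SimpleGraph.Walk.support_mapLe_eq_support] at ht
    by_contra hne
    have h1 := SimpleGraph.Walk.length_takeUntil_lt_length ht hne
    have h2 := hmin t htO (s.bypass.takeUntil t ht)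
    have h3 := s.length_bypass_le_length
    omega

/-- Two internally disjoint paths from `a` to `x`, not both of length one. -/
def TwoPaths (H : SimpleGraph V) (a x : V) : Prop :=
  ∃ p q : H.Walk a x, p.IsPath ∧ q.IsPath ∧ (∀ t ∈ p.support, t ∈ q.support → t = a ∨ t = x) ∧
    1 < q.length

lemma isCycle_append_reverse {H : SimpleGraph V} {a x : V} {p q : H.Walk a x} (hp : p.IsPath)
    (hq : q.IsPath) (hd : ∀ t ∈ p.support, t ∈ q.support → t = a ∨ t = x) (hl : 1 < q.length) :
    (p.append q.reverse).IsCycle := by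
  refine hp.isCycle_append hq.reverse ?_ (Or.inr (by simpa using hl))
  intro t h1 h2
  have hq' := hq.reverse
  have h3 : t ∈ p.support := List.mem_of_mem_tail h1
  have h4 : t ∈ q.reverse.support := List.mem_of_mem_tail h2
  have hpn := hp.support_nodup
  have hqn := hq'.support_nodup
  rw [← SimpleGraph.Walk.cons_tail_support] at hpn hqn
  rcases hd t h3 (by simpa using h4) with rfl | rfl
  · exact (List.nodup_cons.1 hpn).1 h1
  · exact (List.nodup_cons.1 hqn).1 h2

lemma isPath_append {H : SimpleGraph V} {a b c : V} {p : H.Walk a b} {q : H.Walk b c}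
    (hp : p.IsPath) (hq : q.IsPath) (h : ∀ t ∈ p.support, t ∈ q.support → t = b) :
    (p.append q).IsPath := by
  rw [SimpleGraph.Walk.isPath_def, SimpleGraph.Walk.support_append]
  have hqn := hq.support_nodup
  rw [← SimpleGraph.Walk.cons_tail_support] at hqn
  refine List.Nodup.append hp.support_nodup (List.nodup_cons.1 hqn).2 ?_
  intro t h1 h2
  have := h t h1 (List.mem_of_mem_tail h2)
  subst this
  exact (List.nodup_cons.1 hqn).1 h2

lemma TwoPaths.step {H : SimpleGraph V} (hsc : Subcubic H) {a x y : V} (hxa : x ≠ a) (hya : y ≠ a)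
    (hx : TwoPaths H a x) (hxy : H.Adj x y)
    (hb : (H.deleteEdges {s(x, y)}).Reachable y x) : TwoPaths H a y := by
  classical
  obtain ⟨p, q, hp, hq, hd, hl⟩ := hx
  have hyx : y ≠ x := hxy.ne.symm
  have hO : ∃ o ∈ {t | t ∈ p.support ∨ t ∈ q.support}, (del H {x}).Reachable y o := by
    by_contra! hc
    have hyO : ¬(y ∈ p.support ∨ y ∈ q.support) := fun h => hc y h .rfl
    obtain ⟨s, t, hst, hs, ht⟩ := exists_adj_leaving hb
      (S := {t | (del H {x}).Reachable y t}) .rfl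
      (fun h => not_mem_of_reachable_del (by simpa using hyx) h rfl)
    have hsx : s ≠ x := fun h => not_mem_of_reachable_del (S := {x}) (by simpa using hyx) hs h
    have hst' := SimpleGraph.deleteEdges_adj.1 hst
    have htx : t = x := by
      by_contra htx
      exact ht (hs.trans (SimpleGraph.Adj.reachable ⟨hst'.1, hsx, htx⟩))
    subst htx
    have hsy : s ≠ y := by
      rintro rfl
      exact hst'.2 (by simp [Sym2.eq_swap])
    have hcyc := isCycle_append_reverse hp hq hd hl
    have h2 := hcyc.ncard_neighborSet_toSubgraph_eq_two (v := t) (by simp)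
    set c := p.append q.reverse with hc'
    have hsO : ¬(s ∈ p.support ∨ s ∈ q.support) := fun h => hc s h hs
    have hsub : insert s (insert y (c.toSubgraph.neighborSet t)) ⊆ H.neighborSet t := by
      rintro z (rfl | rfl | hz)
      · exact hst'.1.symm
      · exact hxy
      · exact c.toSubgraph.adj_sub hz
    have hmem : ∀ z ∈ c.toSubgraph.neighborSet t, z ∈ p.support ∨ z ∈ q.support := by
      intro z hz
      have : z ∈ c.support := by
        rw [← SimpleGraph.Walk.mem_verts_toSubgraph]
        exact c.toSubgraph.edge_vert hz.symm
      simpa [hc'] using this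
    have hfin := (hsc t).1
    have h4 := Set.ncard_le_ncard hsub hfin
    have hf2 : (c.toSubgraph.neighborSet t).Finite :=
      hfin.subset fun z hz => c.toSubgraph.adj_sub hz
    rw [Set.ncard_insert_of_notMem _ (hf2.insert y), Set.ncard_insert_of_notMem _ hf2, h2] at h4
    · have := (hsc t).2
      omega
    · exact fun h => hyO (hmem y h)
    · rintro (h | h)
      · exact hsy h
      · exact hsO (hmem s h)
  obtain ⟨o, ho, hr⟩ := hO
  obtain ⟨z, hz, s, hs, hxs, hsO⟩ := exists_path_to_set hyx ho hr
  have hzx : z ≠ x := by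
    rintro rfl
    exact hxs (by simp)
  have key : ∀ p q : H.Walk a x, p.IsPath → q.IsPath →
      (∀ t ∈ p.support, t ∈ q.support → t = a ∨ t = x) →
      (∀ t ∈ s.support, t ∈ p.support ∨ t ∈ q.support → t = z) → z ∈ p.support →
      TwoPaths H a y := by
    intro p q hp hq hd hsO hzp
    have hyq : y ∉ q.support := by
      intro hy
      have hyz := hsO y (by simp) (Or.inr hy)
      subst hyz
      rcases hd y hzp hy with h | h
      · exact hya h
      · exact hyx h
    have hxt : x ∉ (p.takeUntil z hzp).support :=
      SimpleGraph.Walk.endpoint_notMem_support_takeUntil hp hzp hzx.symm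
    refine ⟨(p.takeUntil z hzp).append s.reverse, q.concat hxy, ?_, ?_, ?_, ?_⟩
    · refine isPath_append (hp.takeUntil hzp) hs.reverse ?_
      intro t ht hts
      exact hsO t (by simpa using hts) (Or.inl (p.support_takeUntil_subset_support hzp ht))
    · exact hq.concat hyq hxy
    · intro t ht htq
      rw [SimpleGraph.Walk.support_concat, List.mem_append, List.mem_singleton] at htq
      rcases htq with htq | rfl
      · rw [SimpleGraph.Walk.mem_support_append_iff] at ht
        rcases ht with ht | ht
        · rcases hd t (p.support_takeUntil_subset_support hzp ht) htq with h | h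
          · exact Or.inl h
          · exact absurd (h ▸ ht) hxt
        · have htz := hsO t (by simpa using ht) (Or.inr htq)
          subst htz
          rcases hd t hzp htq with h | h
          · exact Or.inl h
          · exact absurd h hzx
      · exact Or.inr rfl
    · rw [SimpleGraph.Walk.length_concat]
      have : q.length ≠ 0 := fun h => hxa (SimpleGraph.Walk.eq_of_length_eq_zero h).symm
      omega
  rcases hz with hz | hz
  · exact key p q hp hq hd hsO hz
  · exact key q p hq hp (fun t h1 h2 => hd t h2 h1) (fun t h1 h2 => hsO t h1 h2.symm) hz

/-- In a bridgeless subcubic graph, any two distinct connected vertices lie on a common cycle. -/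
lemma exists_cycle_through {H : SimpleGraph V} (hsc : Subcubic H)
    (hbr : ∀ x y, H.Adj x y → (H.deleteEdges {s(x, y)}).Reachable x y) {a b : V} (hab : a ≠ b)
    (h : H.Reachable a b) : ∃ c : H.Walk a a, c.IsCycle ∧ b ∈ c.support := by
  classical
  have key := reachable_induction h (fun x => x = a ∨ TwoPaths H a x) (Or.inl rfl) ?_
  · rcases key with h | ⟨p, q, hp, hq, hd, hl⟩
    · exact absurd h.symm hab
    · exact ⟨_, isCycle_append_reverse hp hq hd hl, by simp⟩
  · intro x y hxy hx
    by_cases hya : y = a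
    · exact Or.inl hya
    right
    by_cases hxa : x = a
    · subst hxa
      obtain ⟨q, hq⟩ := SimpleGraph.reachable_deleteEdges_iff_exists_walk.1 (hbr x y hxy)
      have hq' : s(x, y) ∉ q.bypass.edges := fun h => hq (q.edges_bypass_subset_edges h)
      refine ⟨hxy.toWalk, q.bypass, by simp [hxy.ne], q.bypass_isPath, by simp, ?_⟩
      by_contra hl
      have h1 : q.bypass.length = 1 := by
        have : q.bypass.length ≠ 0 := fun h =>
          hxy.ne (SimpleGraph.Walk.eq_of_length_eq_zero h)
        omega
      generalize q.bypass = r at hq' h1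
      match r with
      | .cons _ .nil => simp at hq'
    · exact TwoPaths.step hsc hxa hya (hx.resolve_left hxa) hxy (hbr x y hxy).symm

/-- `B` induces a connected bridgeless subgraph of `G`. -/
def TwoEdgeConnOn (G : SimpleGraph V) (B : Set V) : Prop :=
  (∀ a ∈ B, ∀ b ∈ B, (restr G B).Reachable a b) ∧
    ∀ a b, (restr G B).Adj a b → ((restr G B).deleteEdges {s(a, b)}).Reachable a b

/-- The spanning subgraph of `H` formed by the edges that are not bridges. -/
def nonbridge (H : SimpleGraph V) : SimpleGraph V where
  Adj a b := H.Adj a b ∧ (H.deleteEdges {s(a, b)}).Reachable a b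
  symm := ⟨fun a b h => ⟨h.1.symm, by rw [Sym2.eq_swap]; exact h.2.symm⟩⟩
  loopless := ⟨fun a h => H.loopless.irrefl a h.1⟩

lemma nonbridge_le (H : SimpleGraph V) : nonbridge H ≤ H := fun _ _ h => h.1

lemma nonbridge_le_deleteEdges {H : SimpleGraph V} {a b : V}
    (hab : ¬(H.deleteEdges {s(a, b)}).Reachable a b) :
    nonbridge H ≤ H.deleteEdges {s(a, b)} := by
  intro x y hxy
  rw [SimpleGraph.deleteEdges_adj]
  refine ⟨hxy.1, fun he => hab ?_⟩
  rw [Set.mem_singleton_iff, Sym2.eq_iff] at he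
  rcases he with ⟨rfl, rfl⟩ | ⟨rfl, rfl⟩
  · exact hxy.2
  · have := hxy.2.symm
    rwa [Sym2.eq_swap] at this

lemma nonbridge_reachable_deleteEdges {H : SimpleGraph V} {a b : V}
    (hab : (nonbridge H).Adj a b) : ((nonbridge H).deleteEdges {s(a, b)}).Reachable a b := by
  classical
  obtain ⟨q, hq⟩ := SimpleGraph.reachable_deleteEdges_iff_exists_walk.1 hab.2
  have hq' : s(a, b) ∉ q.bypass.edges := fun h => hq (q.edges_bypass_subset_edges h)
  have hcyc : (SimpleGraph.Walk.cons hab.1.symm q.bypass).IsCycle := by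
    rw [SimpleGraph.Walk.cons_isCycle_iff]
    exact ⟨q.bypass_isPath, by rwa [Sym2.eq_swap]⟩
  refine ⟨q.bypass.transfer _ ?_⟩
  intro e he
  induction e with
  | _ x y =>
    rw [SimpleGraph.mem_edgeSet, SimpleGraph.deleteEdges_adj]
    refine ⟨?_, fun h => hq' (h ▸ he)⟩
    exact SimpleGraph.adj_and_reachable_delete_edges_iff_exists_cycle.2
      ⟨_, _, hcyc, List.mem_cons_of_mem _ he⟩

/-- The 2-edge-connected components of an induced subgraph are bridgeless and connected. -/
lemma twoEdgeConnOn_nonbridge (G : SimpleGraph V) (Y : Set V) {x : V} :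
    TwoEdgeConnOn G {y | (nonbridge (restr G Y)).Reachable x y} := by
  set N := nonbridge (restr G Y) with hN
  set Q : Set V := {y | N.Reachable x y} with hQ
  have hNG : N ≤ G := fun a b h => h.1.1
  have hcl : ∀ a b, N.Adj a b → a ∈ Q → b ∈ Q := fun a b hab ha => ha.trans hab.reachable
  refine ⟨fun a ha b hb => ?_, fun a b hab => ?_⟩
  · exact reachable_restr hNG hcl ha (ha.symm.trans hb)
  · obtain ⟨hab, ha, hb⟩ := hab
    have hr : N.Reachable a b := ha.symm.trans hb
    have hYadj : (restr G Y).Adj a b := by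
      refine ⟨hab, ?_, ?_⟩
      · by_contra haY
        have := reachable_induction hr (· = a) rfl fun s t hst hs => by
          subst hs
          exact absurd hst.1.2.1 haY
        exact hab.ne this.symm
      · by_contra hbY
        have := reachable_induction hr.symm (· = b) rfl fun s t hst hs => by
          subst hs
          exact absurd hst.1.2.1 hbY
        exact hab.ne this
    have hNab : N.Adj a b := by
      refine ⟨hYadj, ?_⟩
      by_contra hbr
      exact hbr (hr.mono (nonbridge_le_deleteEdges hbr))
    have h1 := nonbridge_reachable_deleteEdges hNab
    have h2 : (restr ((restr G Q).deleteEdges {s(a, b)}) Q).Reachable a b := by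
      refine reachable_restr (N := restr (N.deleteEdges {s(a, b)}) Q) ?_ ?_ ha ?_
      · intro s t hst
        rw [SimpleGraph.deleteEdges_adj]
        have h3 := SimpleGraph.deleteEdges_adj.1 hst.1
        exact ⟨⟨hNG h3.1, hst.2⟩, h3.2⟩
      · exact fun s t hst _ => hst.2.2
      · exact reachable_restr le_rfl
          (fun s t hst hs => hcl s t (SimpleGraph.deleteEdges_adj.1 hst).1 hs) ha h1
    have hle : restr ((restr G Q).deleteEdges {s(a, b)}) Q ≤ (restr G Q).deleteEdges {s(a, b)} :=
      fun s t hst => hst.1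
    exact h2.mono hle

/-- A geodesic from `r` to `x` avoids every vertex `b ≠ x` that is at least as far from `r`. -/
lemma reachable_deleteEdges_of_dist_le {H : SimpleGraph V} {r x a b : V} (hr : H.Reachable r x)
    (hxb : x ≠ b) (hd : H.dist r x ≤ H.dist r b) : (H.deleteEdges {s(a, b)}).Reachable r x := by
  classical
  obtain ⟨p, hp⟩ := hr.exists_walk_length_eq_dist
  refine SimpleGraph.reachable_deleteEdges_iff_exists_walk.2 ⟨p, fun he => ?_⟩
  have hb := p.snd_mem_support_of_mem_edges he
  have h1 := SimpleGraph.Walk.length_takeUntil_lt_length hb hxb.symm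
  have h2 := SimpleGraph.dist_le (p.takeUntil b hb)
  omega

/-- A bridge `ab` of `H` such that `b` is farther than `a` from the root `ρ a` of its component. -/
def DownBridge (H : SimpleGraph V) (ρ : V → V) (a b : V) : Prop :=
  H.Adj a b ∧ ¬(H.deleteEdges {s(a, b)}).Reachable a b ∧
    H.dist (ρ b) b = H.dist (ρ a) a + 1

section DownBridge

variable {H : SimpleGraph V} {ρ : V → V}

lemma DownBridge.dist_le (hρ : ∀ x, H.Reachable (ρ x) x)
    (hρc : ∀ x y, H.Reachable x y → ρ x = ρ y) {a b y : V}
    (h : DownBridge H ρ a b)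
    (hy : (nonbridge H).Reachable b y) : H.dist (ρ b) b ≤ H.dist (ρ y) y := by
  by_contra! hlt
  have hb : ρ b = ρ a := hρc _ _ h.1.reachable.symm
  have hyb : ρ y = ρ b := hρc _ _ (hy.mono (nonbridge_le H)).symm
  have h1 : (H.deleteEdges {s(a, b)}).Reachable (ρ b) y := by
    refine reachable_deleteEdges_of_dist_le (hyb ▸ hρ y) ?_ ?_
    · rintro rfl
      exact absurd hlt (lt_irrefl _)
    · rw [hyb] at hlt
      exact hlt.le
  have h2 : (H.deleteEdges {s(a, b)}).Reachable (ρ b) a := by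
    refine reachable_deleteEdges_of_dist_le (hb ▸ hρ a) h.1.ne ?_
    rw [h.2.2, hb]
    omega
  exact h.2.1 (h2.symm.trans (h1.trans (hy.mono (nonbridge_le_deleteEdges h.2.1)).symm))

lemma DownBridge.unique (hρ : ∀ x, H.Reachable (ρ x) x)
    (hρc : ∀ x y, H.Reachable x y → ρ x = ρ y) {a b a' b' : V}
    (h : DownBridge H ρ a b) (h' : DownBridge H ρ a' b')
    (hy : (nonbridge H).Reachable b b') : a = a' ∧ b = b' := by
  have e1 := h.dist_le hρ hρc hy
  have e2 := h'.dist_le hρ hρc hy.symm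
  have hb : ρ b = ρ a := hρc _ _ h.1.reachable.symm
  have hb' : ρ b' = ρ a' := hρc _ _ h'.1.reachable.symm
  have hbb : ρ b' = ρ b := hρc _ _ (hy.mono (nonbridge_le H)).symm
  have e3 := h.2.2
  have e4 := h'.2.2
  by_cases he : s(a', b') = s(a, b)
  · rw [Sym2.eq_iff] at he
    rcases he with ⟨rfl, rfl⟩ | ⟨rfl, rfl⟩
    · exact ⟨rfl, rfl⟩
    · omega
  · exfalso
    have ha'b : a' ≠ b := by
      rintro rfl
      omega
    have h1 : (H.deleteEdges {s(a, b)}).Reachable (ρ b) a' := by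
      refine reachable_deleteEdges_of_dist_le (hbb ▸ hb' ▸ hρ a') ha'b ?_
      have : H.dist (ρ b) a' = H.dist (ρ a') a' := by rw [← hbb, hb']
      omega
    have h2 : (H.deleteEdges {s(a, b)}).Reachable (ρ b) a := by
      refine reachable_deleteEdges_of_dist_le (hb ▸ hρ a) h.1.ne ?_
      rw [h.2.2, hb]
      omega
    have h3 : (H.deleteEdges {s(a, b)}).Reachable a' b' :=
      SimpleGraph.Adj.reachable (SimpleGraph.deleteEdges_adj.2 ⟨h'.1, he⟩)
    exact h.2.1 (h2.symm.trans (h1.trans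
      (h3.trans (hy.mono (nonbridge_le_deleteEdges h.2.1)).symm)))

/-- Every bridge points away from the root in one of its two directions. -/
lemma downBridge_or (hρ : ∀ x, H.Reachable (ρ x) x)
    (hρc : ∀ x y, H.Reachable x y → ρ x = ρ y) {a b : V}
    (hab : H.Adj a b)
    (hbr : ¬(H.deleteEdges {s(a, b)}).Reachable a b) :
    DownBridge H ρ a b ∨ DownBridge H ρ b a := by
  have hb : ρ b = ρ a := hρc _ _ hab.reachable.symm
  have hra := hρ a
  have hrb := hρ b
  rw [hb] at hrb
  have hbr' : ¬(H.deleteEdges {s(b, a)}).Reachable b a := by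
    rw [Sym2.eq_swap]
    exact fun h => hbr h.symm
  have d1 : H.dist (ρ a) b ≤ H.dist (ρ a) a + 1 := by
    obtain ⟨p, hp⟩ := hra.exists_walk_length_eq_dist
    have := SimpleGraph.dist_le (p.concat hab)
    rwa [SimpleGraph.Walk.length_concat, hp] at this
  have d2 : H.dist (ρ a) a ≤ H.dist (ρ a) b + 1 := by
    obtain ⟨p, hp⟩ := hrb.exists_walk_length_eq_dist
    have := SimpleGraph.dist_le (p.concat hab.symm)
    rwa [SimpleGraph.Walk.length_concat, hp] at this
  by_cases he : H.dist (ρ a) a = H.dist (ρ a) b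
  · exfalso
    have h1 : (H.deleteEdges {s(a, b)}).Reachable (ρ a) a :=
      reachable_deleteEdges_of_dist_le hra hab.ne he.le
    have h2 : (H.deleteEdges {s(b, a)}).Reachable (ρ a) b :=
      reachable_deleteEdges_of_dist_le hrb hab.ne.symm he.ge
    rw [Sym2.eq_swap] at h2
    exact hbr (h1.symm.trans h2)
  · by_cases hlt : H.dist (ρ a) a < H.dist (ρ a) b
    · exact Or.inl ⟨hab, hbr, by rw [hb]; omega⟩
    · exact Or.inr ⟨hab.symm, hbr', by rw [hb]; omega⟩

end DownBridge

section Bridges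

variable {G : SimpleGraph V} {B C : Set V}

lemma exists_adj_of_bridge (hB : TwoEdgeConnOn G B) {a b : V}
    (hab : (restr G (B \ C)).Adj a b)
    (hbr : ¬((restr G (B \ C)).deleteEdges {s(a, b)}).Reachable a b) :
    ∃ x, ((restr G (B \ C)).deleteEdges {s(a, b)}).Reachable b x ∧ x ∈ B \ C ∧
      ∃ c ∈ C, G.Adj x c := by
  have h1 := (hB.2 a b ⟨hab.1, hab.2.1.1, hab.2.2.1⟩).symm
  obtain ⟨x, y, hxy, hx, hy⟩ := exists_adj_leaving h1
    (S := {x | ((restr G (B \ C)).deleteEdges {s(a, b)}).Reachable b x ∧ x ∈ B \ C})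
    ⟨.rfl, hab.2.2⟩ (fun h => hbr h.1.symm)
  rw [SimpleGraph.deleteEdges_adj] at hxy
  refine ⟨x, hx.1, hx.2, y, ?_, hxy.1.1⟩
  by_contra hyC
  have hyY : y ∈ B \ C := ⟨hxy.1.2.2, hyC⟩
  exact hy ⟨hx.1.trans (SimpleGraph.Adj.reachable
    (SimpleGraph.deleteEdges_adj.2 ⟨⟨hxy.1.1, hx.2, hyY⟩, hxy.2⟩)), hyY⟩

lemma exists_adj_of_mem (hB : TwoEdgeConnOn G B) (hCB : C ⊆ B) (hC : C.Nonempty) {y : V}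
    (hy : y ∈ B \ C) :
    ∃ x, (restr G (B \ C)).Reachable y x ∧ x ∈ B \ C ∧ ∃ c ∈ C, G.Adj x c := by
  obtain ⟨c, hc⟩ := hC
  obtain ⟨x, z, hxz, hx, hz⟩ := exists_adj_leaving (hB.1 y hy.1 c (hCB hc))
    (S := {x | (restr G (B \ C)).Reachable y x ∧ x ∈ B \ C}) ⟨.rfl, hy⟩ (fun h => h.2.2 hc)
  refine ⟨x, hx.1, hx.2, z, ?_, hxz.1⟩
  by_contra hzC
  have hzY : z ∈ B \ C := ⟨hxz.2.2, hzC⟩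
  exact hz ⟨hx.1.trans (SimpleGraph.Adj.reachable ⟨hxz.1, hx.2, hzY⟩), hzY⟩

/-- Every 2-edge-connected component outside `C` is joined to `C`, or has a bridge leaving it away
from the root. -/
lemma exists_exit (hB : TwoEdgeConnOn G B) (hCB : C ⊆ B) (hC : C.Nonempty) {ρ : V → V}
    (hρ : ∀ x, (restr G (B \ C)).Reachable (ρ x) x)
    (hρc : ∀ x y, (restr G (B \ C)).Reachable x y → ρ x = ρ y) {y : V} (hy : y ∈ B \ C) :
    ∃ u p, (nonbridge (restr G (B \ C))).Reachable y u ∧ G.Adj u p ∧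
      (p ∈ C ∨ DownBridge (restr G (B \ C)) ρ u p) := by
  set H := restr G (B \ C) with hH
  by_contra! hc
  have hstuck : ∀ s t, H.Adj s t → (nonbridge H).Reachable y s → ¬(nonbridge H).Reachable y t →
      DownBridge H ρ t s := by
    intro s t hst hs ht
    have hbr : ¬(H.deleteEdges {s(s, t)}).Reachable s t := fun h =>
      ht (hs.trans (SimpleGraph.Adj.reachable (G := nonbridge H) ⟨hst, h⟩))
    exact (downBridge_or hρ hρc hst hbr).resolve_left (hc s t hs hst.1).2
  by_cases hin : ∃ a b, DownBridge H ρ a b ∧ (nonbridge H).Reachable y b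
  · obtain ⟨a, b, hab, hyb⟩ := hin
    obtain ⟨x, hbx, hx, c, hcC, hxc⟩ := exists_adj_of_bridge hB hab.1 hab.2.1
    obtain ⟨s, t, hst, hs, ht⟩ := exists_adj_leaving hbx
      (S := {x | (nonbridge H).Reachable y x}) hyb (fun h => (hc x c h hxc).1 hcC)
    rw [SimpleGraph.deleteEdges_adj] at hst
    have := hab.unique hρ hρc (hstuck s t hst.1 hs ht) (hyb.symm.trans hs)
    exact hst.2 (by simp [this.1, this.2, Sym2.eq_swap])
  · push Not at hin
    obtain ⟨x, hyx, hx, c, hcC, hxc⟩ := exists_adj_of_mem hB hCB hC hy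
    obtain ⟨s, t, hst, hs, ht⟩ := exists_adj_leaving hyx
      (S := {x | (nonbridge H).Reachable y x}) .rfl (fun h => (hc x c h hxc).1 hcC)
    exact hin t s (hstuck s t hst hs ht) hs

lemma finite_bridges (hG : Subcubic G) (hB : TwoEdgeConnOn G B) (hC : C.Finite) :
    {a | ∃ b, (restr G (B \ C)).Adj a b ∧
      ¬((restr G (B \ C)).deleteEdges {s(a, b)}).Reachable a b}.Finite := by
  classical
  set H := restr G (B \ C) with hH
  set A : Set V := {x | ∃ c ∈ C, G.Adj x c} with hA
  have hAf : A.Finite := by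
    refine (hC.biUnion fun c _ => (hG c).1).subset ?_
    rintro x ⟨c, hc, hxc⟩
    exact Set.mem_biUnion hc hxc.symm
  let W : V × V → Set V := fun xy =>
    if h : H.Reachable xy.1 xy.2 then {z | z ∈ h.some.support} else ∅
  have hW : ∀ xy, (W xy).Finite := by
    intro xy
    by_cases h : H.Reachable xy.1 xy.2
    · simp only [W, h, dite_true]
      exact List.finite_toSet _
    · simp [W, h]
  refine ((hAf.prod hAf).biUnion fun xy _ => hW xy).subset ?_
  rintro a ⟨b, hab, hbr⟩
  obtain ⟨y, hby, -, hyA⟩ := exists_adj_of_bridge hB hab hbr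
  have hbr' : ¬(H.deleteEdges {s(b, a)}).Reachable b a := by
    rw [Sym2.eq_swap]
    exact fun h => hbr h.symm
  obtain ⟨x, hax, -, hxA⟩ := exists_adj_of_bridge hB hab.symm hbr'
  rw [Sym2.eq_swap] at hax
  have hle : H.deleteEdges {s(a, b)} ≤ H := SimpleGraph.deleteEdges_le _
  have hxy : H.Reachable x y :=
    (hax.mono hle).symm.trans (hab.reachable.trans (hby.mono hle))
  refine Set.mem_biUnion (show (x, y) ∈ A ×ˢ A from ⟨hxA, hyA⟩) ?_
  simp only [W, hxy, dite_true]
  by_contra ha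
  refine hbr (hax.trans (Reachable.trans ?_ hby.symm))
  exact SimpleGraph.reachable_deleteEdges_iff_exists_walk.2
    ⟨hxy.some, fun h => ha (hxy.some.fst_mem_support_of_mem_edges h)⟩

end Bridges

/-- A piece of the recursive decomposition: a vertex set `B`, two terminals `u` and `v` in `B`, a
vertex `p` outside `B` to which `u` is to be joined, and a rank used to order sibling pieces. -/
structure Piece (V : Type u) where
  B : Set V
  u : V
  v : V
  p : V
  r : ℕ

/-- A piece is admissible if it induces a connected bridgeless graph containing its terminals. -/
structure Piece.Admissible (G : SimpleGraph V) (s : Piece V) : Prop where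
  conn : TwoEdgeConnOn G s.B
  u_mem : s.u ∈ s.B
  v_mem : s.v ∈ s.B

/-- A decomposition of a piece `s` into a core `C` (a cycle `K` through both terminals, or a single
vertex) and smaller pieces `ch x`, one for every `x` outside the core, where each smaller piece is
joined by an edge to the core or to the second terminal of a sibling. -/
structure Refinement (G : SimpleGraph V) (s : Piece V) (w : V) where
  C : Set V
  K : SimpleGraph V
  T : Set V
  ch : V → Piece V
  C_fin : C.Finite
  C_sub : C ⊆ s.B
  u_mem : s.u ∈ C
  v_mem : s.v ∈ C
  w_mem : s.u = s.v → w ∈ C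
  K_le : K ≤ G
  K_mem : ∀ a b, K.Adj a b → a ∈ C
  K_conn : ∀ a ∈ C, ∀ b ∈ C, K.Reachable a b
  K_deg : s.B = {s.u} ∨ ∀ a ∈ C, (K.neighborSet a).ncard = 2
  T_fin : T.Finite
  C_sub_T : C ⊆ T
  T_sep : ∀ a ∈ s.B, ∀ b ∈ s.B, a ∉ T → b ∉ T → G.Adj a b → ch a = ch b
  ch_adm : ∀ x ∈ s.B \ C, (ch x).Admissible G
  ch_mem : ∀ x ∈ s.B \ C, x ∈ (ch x).B
  ch_sub : ∀ x ∈ s.B \ C, (ch x).B ⊆ s.B \ C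
  ch_eq : ∀ x ∈ s.B \ C, ∀ y ∈ (ch x).B, ch y = ch x
  ch_adj : ∀ x ∈ s.B \ C, G.Adj (ch x).u (ch x).p
  ch_p : ∀ x ∈ s.B \ C, (ch x).p ∈ C ∨ ((ch x).p ∈ s.B \ C ∧
    (ch (ch x).p).v = (ch x).p ∧ (ch (ch x).p).r < (ch x).r)
  ch_unique : ∀ x ∈ s.B \ C, ∀ y ∈ s.B \ C, (ch x).p = (ch y).p → (ch x).p ∉ C → ch x = ch y
  w_ch : w ∈ s.B \ C → (ch w).u = (ch w).v

lemma exists_core {G : SimpleGraph V} (hG : Subcubic G) {s : Piece V} (hs : s.Admissible G) {w : V}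
    (hw : w ∈ s.B) : ∃ (C : Set V) (K : SimpleGraph V), C.Finite ∧ C ⊆ s.B ∧ s.u ∈ C ∧ s.v ∈ C ∧
      (s.u = s.v → w ∈ C) ∧ K ≤ G ∧ (∀ a b, K.Adj a b → a ∈ C) ∧
      (∀ a ∈ C, ∀ b ∈ C, K.Reachable a b) ∧
      (s.B = {s.u} ∨ ∀ a ∈ C, (K.neighborSet a).ncard = 2) := by
  by_cases hB : s.B = {s.u}
  · have hv : s.v = s.u := by
      have := hs.v_mem
      rwa [hB] at this
    have hw' : w = s.u := by rwa [hB] at hw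
    refine ⟨{s.u}, ⊥, Set.finite_singleton _, ?_, rfl, hv, fun _ => hw', bot_le, ?_, ?_, Or.inl hB⟩
    · rw [← hB]
    · intro a b h
      exact absurd h (by simp)
    · rintro a rfl b rfl
      exact .rfl
  · obtain ⟨b, hb, hbu, hbv, hbw⟩ :
        ∃ b ∈ s.B, s.u ≠ b ∧ (s.u ≠ s.v → b = s.v) ∧ (s.u = s.v → w = s.u ∨ w = b) := by
      by_cases huv : s.u = s.v
      · by_cases hwu : w = s.u
        · have : ∃ b ∈ s.B, b ≠ s.u := by
            by_contra! hc
            exact hB (Set.eq_singleton_iff_unique_mem.2 ⟨hs.u_mem, hc⟩)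
          obtain ⟨b, hb, hbu⟩ := this
          exact ⟨b, hb, hbu.symm, fun h => absurd huv h, fun _ => Or.inl hwu⟩
        · exact ⟨w, hw, fun h => hwu h.symm, fun h => absurd huv h, fun _ => Or.inr rfl⟩
      · exact ⟨s.v, hs.v_mem, huv, fun _ => rfl, fun h => absurd h huv⟩
    have hle : restr G s.B ≤ G := fun _ _ h => h.1
    have hsub : Subcubic (restr G s.B) := fun x => by
      have hss : (restr G s.B).neighborSet x ⊆ G.neighborSet x := fun _ h => hle h
      exact ⟨(hG x).1.subset hss, (Set.ncard_le_ncard hss (hG x).1).trans (hG x).2⟩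
    obtain ⟨c, hc, hbc⟩ := exists_cycle_through hsub hs.conn.2 hbu (hs.conn.1 _ hs.u_mem _ hb)
    have hcard : ∀ a ∈ c.support, (c.toSubgraph.neighborSet a).ncard = 2 := fun a ha =>
      hc.ncard_neighborSet_toSubgraph_eq_two ha
    refine ⟨{x | x ∈ c.support}, c.toSubgraph.spanningCoe, List.finite_toSet _, ?_, by simp, ?_, ?_,
      ?_, ?_, ?_, Or.inr hcard⟩
    · intro x hx
      obtain ⟨y, hy⟩ : (c.toSubgraph.neighborSet x).Nonempty := by
        rw [Set.nonempty_iff_ne_empty]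
        intro h
        have := hcard x hx
        rw [h] at this
        simp at this
      exact (c.toSubgraph.adj_sub hy).2.1
    · by_cases huv : s.u = s.v
      · rw [← huv]
        simp
      · rw [← hbv huv]
        exact hbc
    · intro huv
      rcases hbw huv with h | h
      · rw [h]
        simp
      · rw [h]
        exact hbc
    · exact c.toSubgraph.spanningCoe_le.trans hle
    · intro a b h
      exact (SimpleGraph.Walk.mem_verts_toSubgraph c).1 (c.toSubgraph.edge_vert h)
    · intro a ha b hb
      have hconn := c.toSubgraph_connected
      have := hconn.coe.preconnected ⟨a, (SimpleGraph.Walk.mem_verts_toSubgraph c).2 ha⟩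
        ⟨b, (SimpleGraph.Walk.mem_verts_toSubgraph c).2 hb⟩
      exact this.map c.toSubgraph.coeEmbeddingSpanningCoe.toHom

lemma exists_refinement {G : SimpleGraph V} (hG : Subcubic G) {s : Piece V} (hs : s.Admissible G)
    {w : V} (hw : w ∈ s.B) : Nonempty (Refinement G s w) := by
  classical
  obtain ⟨C, K, hCf, hCB, huC, hvC, hwC, hKG, hKC, hKconn, hKdeg⟩ := exists_core hG hs hw
  set H := restr G (s.B \ C) with hH
  set N := nonbridge H with hN
  let ρ : V → V := fun x => if H.Reachable x w then w else (H.connectedComponentMk x).out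
  have hρ : ∀ x, H.Reachable (ρ x) x := by
    intro x
    by_cases h : H.Reachable x w
    · simpa [ρ, h] using h.symm
    · simpa [ρ, h] using SimpleGraph.ConnectedComponent.exact (Quot.out_eq (H.connectedComponentMk x))
  have hρc : ∀ x y, H.Reachable x y → ρ x = ρ y := by
    intro x y h
    have h1 : H.Reachable x w ↔ H.Reachable y w := ⟨h.symm.trans, h.trans⟩
    simp only [ρ, h1, SimpleGraph.ConnectedComponent.sound h]
  have hρw : ρ w = w := by simp [ρ]
  let d : V → ℕ := fun x => H.dist (ρ x) x
  set A : Set V := {a | ∃ b, H.Adj a b ∧ ¬(H.deleteEdges {s(a, b)}).Reachable a b} with hA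
  have hAf : A.Finite := finite_bridges hG hs.conn hCf
  obtain ⟨M, hM⟩ : ∃ M, ∀ a ∈ A, d a ≤ M := by
    obtain ⟨M, hM⟩ := (hAf.image d).bddAbove
    exact ⟨M, fun a ha => hM ⟨a, ha, rfl⟩⟩
  let rep : V → V := fun x => (N.connectedComponentMk x).out
  have hrep : ∀ x, N.Reachable (rep x) x := fun x =>
    SimpleGraph.ConnectedComponent.exact (Quot.out_eq (N.connectedComponentMk x))
  have hrepc : ∀ x y, N.Reachable x y → rep x = rep y := fun x y h => by
    simp only [rep, SimpleGraph.ConnectedComponent.sound h]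
  have hNY : ∀ x y, N.Reachable x y → x ∈ s.B \ C → y ∈ s.B \ C := fun x y h hx =>
    reachable_induction h (· ∈ s.B \ C) hx fun a b hab _ => hab.1.2.2
  have hexit : ∀ z, ∃ u p, z ∈ s.B \ C → N.Reachable z u ∧ G.Adj u p ∧
      (p ∈ C ∨ DownBridge H ρ u p) := by
    intro z
    by_cases hz : z ∈ s.B \ C
    · obtain ⟨u, p, h⟩ := exists_exit hs.conn hCB ⟨_, huC⟩ hρ hρc hz
      exact ⟨u, p, fun _ => h⟩
    · exact ⟨z, z, fun h => absurd h hz⟩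
  choose U P hUP using hexit
  have hent : ∀ z, ∃ v, (∃ a, DownBridge H ρ a v ∧ N.Reachable z v) ∨
      (v = U z ∧ ∀ a b, DownBridge H ρ a b → ¬N.Reachable z b) := by
    intro z
    by_cases h : ∃ a b, DownBridge H ρ a b ∧ N.Reachable z b
    · obtain ⟨a, b, h⟩ := h
      exact ⟨b, Or.inl ⟨a, h⟩⟩
    · push Not at h
      exact ⟨U z, Or.inr ⟨rfl, h⟩⟩
  choose E hE using hent
  let f : V → Piece V := fun z => ⟨{y | N.Reachable z y}, U z, E z, P z, M - d (E z)⟩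
  have hrY : ∀ x ∈ s.B \ C, rep x ∈ s.B \ C := fun x hx => hNY _ _ (hrep x).symm hx
  refine ⟨⟨C, K, C ∪ A, fun x => f (rep x), hCf, hCB, huC, hvC, hwC, hKG, hKC, hKconn, hKdeg,
    hCf.union hAf, Set.subset_union_left, ?_, ?_, ?_, ?_, ?_, ?_, ?_, ?_, ?_⟩⟩
  · intro a ha b hb haT hbT hab
    have h1 : H.Adj a b := ⟨hab, ⟨ha, fun h => haT (Or.inl h)⟩, ⟨hb, fun h => hbT (Or.inl h)⟩⟩
    have h2 : N.Adj a b := ⟨h1, by_contra fun h => haT (Or.inr ⟨b, h1, h⟩)⟩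
    simp only [hrepc a b h2.reachable]
  · intro x hx
    refine ⟨twoEdgeConnOn_nonbridge G _, (hUP _ (hrY x hx)).1, ?_⟩
    rcases hE (rep x) with ⟨a, -, h⟩ | ⟨h, -⟩
    · exact h
    · change N.Reachable (rep x) (E (rep x))
      rw [h]
      exact (hUP _ (hrY x hx)).1
  · intro x _
    exact hrep x
  · intro x hx y hy
    exact hNY _ _ hy (hrY x hx)
  · intro x _ y hy
    simp only [hrepc x y ((hrep x).symm.trans hy)]
  · intro x hx
    exact (hUP _ (hrY x hx)).2.1
  · intro x hx
    obtain ⟨h1, -, h3⟩ := hUP _ (hrY x hx)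
    refine h3.imp id fun hdb => ?_
    change P (rep x) ∈ s.B \ C ∧ E (rep (P (rep x))) = P (rep x) ∧
      M - d (E (rep (P (rep x)))) < M - d (E (rep x))
    have hv : E (rep (P (rep x))) = P (rep x) := by
      rcases hE (rep (P (rep x))) with ⟨a, ha, hr⟩ | ⟨-, h⟩
      · exact (ha.unique hρ hρc hdb (hr.symm.trans (hrep _))).2
      · exact absurd (hrep _) (h _ _ hdb)
    refine ⟨hdb.1.2.2, hv, ?_⟩
    rw [hv]
    have hA' : P (rep x) ∈ A := ⟨U (rep x), hdb.1.symm, fun h => hdb.2.1 (by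
      rw [Sym2.eq_swap]
      exact h.symm)⟩
    have e1 := hM _ hA'
    have e2 : d (P (rep x)) = d (U (rep x)) + 1 := hdb.2.2
    have e3 : d (E (rep x)) ≤ d (U (rep x)) := by
      rcases hE (rep x) with ⟨a, ha, hr⟩ | ⟨h, -⟩
      · exact ha.dist_le hρ hρc (hr.symm.trans h1)
      · rw [h]
    omega
  · intro x hx y hy hp hpC
    have hx' := hUP _ (hrY x hx)
    have hy' := hUP _ (hrY y hy)
    change P (rep x) = P (rep y) at hp
    change P (rep x) ∉ C at hpC
    have h1 := hx'.2.2.resolve_left hpC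
    have h2 := hy'.2.2.resolve_left (hp ▸ hpC)
    rw [← hp] at h2
    have h3 := (h1.unique hρ hρc h2 .rfl).1
    have h4 := hx'.1
    rw [h3] at h4
    have : rep x = rep y :=
      hrepc x y ((hrep x).symm.trans (h4.trans (hy'.1.symm.trans (hrep y))))
    simp only [this]
  · intro hw'
    rcases hE (rep w) with ⟨a, ha, hr⟩ | ⟨h, -⟩
    · have e1 := ha.dist_le hρ hρc (hr.symm.trans (hrep w))
      have e2 := ha.2.2
      rw [hρw, SimpleGraph.dist_self] at e1
      omega
    · exact h.symm

section Decomposition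

variable {G : SimpleGraph V} {w : {s : Piece V // s.Admissible G} → V}
  {ref : ∀ s : {s : Piece V // s.Admissible G}, Refinement G s.1 (w s)}
  {s₀ : {s : Piece V // s.Admissible G}}

/-- `Reach ref s₀ n s` says that `s` is obtained from `s₀` by passing `n` times to a smaller piece of
the chosen refinement. -/
inductive Reach (ref : ∀ s : {s : Piece V // s.Admissible G}, Refinement G s.1 (w s))
    (s₀ : {s : Piece V // s.Admissible G}) : ℕ → {s : Piece V // s.Admissible G} → Prop
  | root : Reach ref s₀ 0 s₀
  | step {n : ℕ} {s : {s : Piece V // s.Admissible G}} (h : Reach ref s₀ n s) {x : V}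
      (hx : x ∈ s.1.B \ (ref s).C) :
      Reach ref s₀ (n + 1) ⟨(ref s).ch x, (ref s).ch_adm x hx⟩

lemma Reach.exists_parent {n : ℕ} {t : {s : Piece V // s.Admissible G}}
    (h : Reach ref s₀ (n + 1) t) :
    ∃ s, Reach ref s₀ n s ∧ t.1.B ⊆ s.1.B \ (ref s).C ∧ ∀ y ∈ t.1.B, (ref s).ch y = t.1 := by
  obtain _ | ⟨h, hx⟩ := h
  exact ⟨_, h, (ref _).ch_sub _ hx, (ref _).ch_eq _ hx⟩

lemma Reach.eq_of_mem {n : ℕ} {s t : {s : Piece V // s.Admissible G}} (hs : Reach ref s₀ n s)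
    (ht : Reach ref s₀ n t) {x : V} (hxs : x ∈ s.1.B) (hxt : x ∈ t.1.B) : s = t := by
  induction n generalizing s t with
  | zero =>
    obtain _ | _ := hs
    obtain _ | _ := ht
    rfl
  | succ n ih =>
    obtain ⟨s', hs', hss, hsc⟩ := hs.exists_parent
    obtain ⟨t', ht', htt, htc⟩ := ht.exists_parent
    obtain rfl := ih hs' ht' (hss hxs).1 (htt hxt).1
    exact Subtype.ext ((hsc x hxs).symm.trans (htc x hxt))

lemma Reach.exists_ancestor {m n : ℕ} {t : {s : Piece V // s.Admissible G}}
    (ht : Reach ref s₀ n t) (hmn : m < n) :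
    ∃ s, Reach ref s₀ m s ∧ t.1.B ⊆ s.1.B \ (ref s).C := by
  induction n generalizing t with
  | zero => omega
  | succ n ih =>
    obtain ⟨s, hs, hts, -⟩ := ht.exists_parent
    rcases Nat.lt_succ_iff_lt_or_eq.1 hmn with h | rfl
    · obtain ⟨q, hq, hsq⟩ := ih hs h
      exact ⟨q, hq, fun x hx => hsq (hts hx).1⟩
    · exact ⟨s, hs, hts⟩

lemma Reach.le_of_mem {m n : ℕ} {s t : {s : Piece V // s.Admissible G}}
    (hs : Reach ref s₀ m s) (ht : Reach ref s₀ n t) {x : V} (hxs : x ∈ (ref s).C)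
    (hxt : x ∈ t.1.B) : n ≤ m := by
  by_contra! hlt
  obtain ⟨q, hq, hqt⟩ := ht.exists_ancestor hlt
  obtain rfl := hs.eq_of_mem hq ((ref s).C_sub hxs) (hqt hxt).1
  exact (hqt hxt).2 hxs

lemma Reach.eq_of_mem_core {m n : ℕ} {s t : {s : Piece V // s.Admissible G}}
    (hs : Reach ref s₀ m s) (ht : Reach ref s₀ n t) {x : V} (hxs : x ∈ (ref s).C)
    (hxt : x ∈ (ref t).C) : m = n ∧ s = t := by
  obtain rfl := (ht.le_of_mem hs hxt ((ref s).C_sub hxs)).antisymm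
    (hs.le_of_mem ht hxs ((ref t).C_sub hxt))
  exact ⟨rfl, hs.eq_of_mem ht ((ref s).C_sub hxs) ((ref t).C_sub hxt)⟩

lemma Reach.subset_of_le {m n : ℕ} {s t : {s : Piece V // s.Admissible G}}
    (hs : Reach ref s₀ m s) (ht : Reach ref s₀ n t) (hmn : m ≤ n) {x : V} (hxs : x ∈ s.1.B)
    (hxt : x ∈ t.1.B) : t.1.B ⊆ s.1.B := by
  rcases hmn.lt_or_eq with h | rfl
  · obtain ⟨q, hq, hqt⟩ := ht.exists_ancestor h
    obtain rfl := hs.eq_of_mem hq hxs (hqt hxt).1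
    exact fun y hy => (hqt hy).1
  · rw [hs.eq_of_mem ht hxs hxt]

/-- If the pieces are refined so as to absorb their first vertices in a fixed enumeration, every
vertex is eventually contained in a core. -/
lemma exists_mem_core {idx : V → ℕ} (hidx : Function.Injective idx)
    (hw : ∀ s, w s ∈ s.1.B ∧ ∀ y ∈ s.1.B, idx (w s) ≤ idx y) {x : V} (hx : x ∈ s₀.1.B) :
    ∃ n s, Reach ref s₀ n s ∧ x ∈ (ref s).C := by
  by_contra! hc
  have key : ∀ k : ℕ, ∃ n s, Reach ref s₀ n s ∧ x ∈ s.1.B ∧ ∀ y ∈ s.1.B, k ≤ idx y := by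
    intro k
    induction k with
    | zero => exact ⟨0, s₀, .root, hx, fun _ _ => Nat.zero_le _⟩
    | succ k ih =>
      obtain ⟨n, s, hs, hxs, hk⟩ := ih
      have hgt : ∀ t : {s : Piece V // s.Admissible G}, t.1.B ⊆ s.1.B → w s ∉ t.1.B →
          ∀ y ∈ t.1.B, k + 1 ≤ idx y := by
        intro t hts hwt y hy
        have h1 := hk _ (hw s).1
        have h2 := (hw s).2 y (hts hy)
        have h3 : idx (w s) ≠ idx y := fun h => hwt (hidx h ▸ hy)
        omega
      have hxC : x ∈ s.1.B \ (ref s).C := ⟨hxs, hc n s hs⟩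
      have ht := hs.step hxC
      set t : {s : Piece V // s.Admissible G} := ⟨(ref s).ch x, (ref s).ch_adm x hxC⟩ with htdef
      have hts : t.1.B ⊆ s.1.B \ (ref s).C := (ref s).ch_sub x hxC
      have hxt : x ∈ t.1.B := (ref s).ch_mem x hxC
      by_cases hwt : w s ∈ t.1.B
      · have hchw : (ref s).ch (w s) = t.1 := (ref s).ch_eq x hxC _ hwt
        have huv : t.1.u = t.1.v := hchw ▸ (ref s).w_ch (hts hwt)
        have hww : w t = w s :=
          hidx (((hw t).2 _ hwt).antisymm ((hw s).2 _ (hts (hw t).1).1))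
        have hwC : w s ∈ (ref t).C := hww ▸ (ref t).w_mem huv
        have hxC' : x ∈ t.1.B \ (ref t).C := ⟨hxt, hc _ t ht⟩
        have hsub := (ref t).ch_sub x hxC'
        exact ⟨_, _, ht.step hxC', (ref t).ch_mem x hxC',
          hgt _ (fun y hy => (hts (hsub hy).1).1) fun h => (hsub h).2 hwC⟩
      · exact ⟨_, t, ht, hxt, hgt t (fun y hy => (hts hy).1) hwt⟩
  obtain ⟨n, s, -, hxs, h⟩ := key (idx x + 1)
  have := h x hxs
  omega

lemma Reach.adj {n : ℕ} {t : {s : Piece V // s.Admissible G}} (h : Reach ref s₀ (n + 1) t) :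
    G.Adj t.1.u t.1.p := by
  obtain _ | ⟨h, hx⟩ := h
  exact (ref _).ch_adj _ hx

/-- The vertex to which a piece is joined belongs to the core of the surrounding piece, or is the
second terminal of a sibling of smaller rank. -/
lemma Reach.p_mem {n : ℕ} {t : {s : Piece V // s.Admissible G}} (h : Reach ref s₀ (n + 1) t) :
    ∃ s, Reach ref s₀ n s ∧ t.1.B ⊆ s.1.B \ (ref s).C ∧ t.1.p ∈ s.1.B ∧
      (t.1.p ∈ (ref s).C ∨ ∃ q, Reach ref s₀ (n + 1) q ∧ t.1.p ∈ (ref q).C ∧ q.1.r < t.1.r) := by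
  obtain _ | @⟨_, s, h, x, hx⟩ := h
  refine ⟨s, h, (ref s).ch_sub _ hx, ?_⟩
  rcases (ref s).ch_p x hx with hp | ⟨hp, hv, hr⟩
  · exact ⟨(ref s).C_sub hp, Or.inl hp⟩
  · refine ⟨hp.1, Or.inr ⟨_, h.step hp, ?_, hr⟩⟩
    have h := (ref ⟨(ref s).ch ((ref s).ch x).p, (ref s).ch_adm _ hp⟩).v_mem
    change ((ref s).ch ((ref s).ch x).p).v ∈ _ at h
    rwa [hv] at h

lemma Reach.p_not_mem {n : ℕ} {t : {s : Piece V // s.Admissible G}} (h : Reach ref s₀ (n + 1) t) :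
    t.1.p ∉ (ref t).C := by
  intro hp
  obtain ⟨s, hs, -, -, hps | ⟨q, hq, hpq, hr⟩⟩ := h.p_mem
  · have := (hs.eq_of_mem_core h hps hp).1
    omega
  · rw [(hq.eq_of_mem_core h hpq hp).2] at hr
    exact lt_irrefl _ hr

lemma Reach.eq_of_p_eq {k m n : ℕ} {q s t : {s : Piece V // s.Admissible G}}
    (hq : Reach ref s₀ k q) (hqB : q.1.B ⊆ (ref q).C) (hs : Reach ref s₀ (m + 1) s)
    (ht : Reach ref s₀ (n + 1) t) (hsq : s.1.p ∈ (ref q).C) (hst : s.1.p = t.1.p) : s = t := by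
  have key : ∀ m s, Reach ref s₀ (m + 1) s → s.1.p ∈ (ref q).C → k = m + 1 := by
    intro m s hs hsq
    obtain ⟨s', hs', hss, -, hp | ⟨q', hq', hp, -⟩⟩ := hs.p_mem
    · obtain rfl := (hs'.eq_of_mem_core hq hp hsq).2
      exact absurd (hqB (hss s.2.u_mem).1) (hss s.2.u_mem).2
    · exact (hq.eq_of_mem_core hq' hsq hp).1
  obtain rfl := key m s hs hsq
  obtain rfl : m = n := by
    have := key n t ht (hst ▸ hsq)
    omega
  obtain _ | @⟨_, s', hs', x, hx⟩ := hs
  obtain _ | @⟨_, t', ht', y, hy⟩ := ht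
  have hs'p : ((ref s').ch x).p ∈ s'.1.B \ (ref s').C := by
    rcases (ref s').ch_p x hx with hp | ⟨hp, -⟩
    · have := (hs'.eq_of_mem_core hq hp hsq).1
      omega
    · exact hp
  have ht'p : ((ref t').ch y).p ∈ t'.1.B := by
    rcases (ref t').ch_p y hy with hp | ⟨hp, -⟩
    · exact (ref t').C_sub hp
    · exact hp.1
  obtain rfl := hs'.eq_of_mem ht' hs'p.1 (by rw [show ((ref s').ch x).p = _ from hst]; exact ht'p)
  exact Subtype.ext ((ref s').ch_unique x hx y hy hst hs'p.2)

/-- The union of the cores and of the edges joining the pieces. -/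
def cactus (ref : ∀ s : {s : Piece V // s.Admissible G}, Refinement G s.1 (w s))
    (s₀ : {s : Piece V // s.Admissible G}) : SimpleGraph V where
  Adj a b := (∃ n s, Reach ref s₀ n s ∧ (ref s).K.Adj a b) ∨
    ∃ n t, Reach ref s₀ (n + 1) t ∧ (a = t.1.u ∧ b = t.1.p ∨ a = t.1.p ∧ b = t.1.u)
  symm := ⟨by
    rintro a b (⟨n, s, h, hab⟩ | ⟨n, t, h, hab⟩)
    · exact Or.inl ⟨n, s, h, hab.symm⟩
    · exact Or.inr ⟨n, t, h, by tauto⟩⟩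
  loopless := ⟨by
    rintro a (⟨n, s, h, hab⟩ | ⟨n, t, h, hab⟩)
    · exact hab.ne rfl
    · rcases hab with ⟨h1, h2⟩ | ⟨h1, h2⟩
      · exact h.adj.ne (h1.symm.trans h2)
      · exact h.adj.ne (h2.symm.trans h1)⟩

lemma cactus_le : cactus ref s₀ ≤ G := by
  rintro a b (⟨n, s, h, hab⟩ | ⟨n, t, h, ⟨rfl, rfl⟩ | ⟨rfl, rfl⟩⟩)
  · exact (ref s).K_le hab
  · exact h.adj
  · exact h.adj.symm

lemma Refinement.core_reachable {s : Piece V} {x : V} (ρ : Refinement G s x) {F : SimpleGraph V}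
    (hF : ρ.K ≤ F) {B : Set V} (hB : ρ.C ⊆ B) {a b : V} (ha : a ∈ ρ.C) (hb : b ∈ ρ.C) :
    (restr F B).Reachable a b :=
  (ρ.K_conn a ha b hb).mono fun _ _ h =>
    ⟨hF h, hB (ρ.K_mem _ _ h), hB (ρ.K_mem _ _ h.symm)⟩

lemma cactus_reachable_u (hcov : ∀ x, ∃ n s, Reach ref s₀ n s ∧ x ∈ (ref s).C)
    {m : ℕ} {t : {s : Piece V // s.Admissible G}} (ht : Reach ref s₀ m t) {x : V}
    (hx : x ∈ t.1.B) : (restr (cactus ref s₀) t.1.B).Reachable x t.1.u := by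
  have key : ∀ n r : ℕ, ∀ s, Reach ref s₀ n s → s.1.r = r → ∀ x ∈ (ref s).C, x ∈ t.1.B →
      (restr (cactus ref s₀) t.1.B).Reachable x t.1.u := by
    intro n
    induction n using Nat.strong_induction_on with
    | _ n ihn =>
    intro r
    induction r using Nat.strong_induction_on with
    | _ r ihr =>
    rintro s hs rfl x hxs hxt
    have hK : (ref s).K ≤ cactus ref s₀ := fun a b h => Or.inl ⟨n, s, hs, h⟩
    have hmn := hs.le_of_mem ht hxs hxt
    have hst : s.1.B ⊆ t.1.B := ht.subset_of_le hs hmn hxt ((ref s).C_sub hxs)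
    have hxu : (restr (cactus ref s₀) t.1.B).Reachable x s.1.u :=
      (ref s).core_reachable hK (fun y hy => hst ((ref s).C_sub hy)) hxs (ref s).u_mem
    rcases hmn.lt_or_eq with hlt | rfl
    · obtain ⟨n, rfl⟩ : ∃ k, n = k + 1 := ⟨n - 1, by omega⟩
      obtain ⟨s', hs', hss', hps', hp⟩ := hs.p_mem
      have hpt : s.1.p ∈ t.1.B :=
        ht.subset_of_le hs' (by omega) hxt (hss' ((ref s).C_sub hxs)).1 hps'
      have hup : (restr (cactus ref s₀) t.1.B).Adj s.1.u s.1.p :=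
        ⟨Or.inr ⟨n, s, hs, Or.inl ⟨rfl, rfl⟩⟩, hst s.2.u_mem, hpt⟩
      refine hxu.trans (hup.reachable.trans ?_)
      rcases hp with hp | ⟨q, hq, hpq, hr⟩
      · exact ihn n (by omega) _ s' hs' rfl _ hp hpt
      · exact ihr _ hr q hq rfl _ hpq hpt
    · rwa [ht.eq_of_mem hs hxt ((ref s).C_sub hxs)] at hxu ⊢
  obtain ⟨n, s, hs, hxs⟩ := hcov x
  exact key _ _ _ hs rfl x hxs hx

end Decomposition

/-- In a graph that is 2-regular on a finite set `X`, the number of edges leaving `X` is not one. -/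
lemma false_of_unique_exit {H : SimpleGraph V} {X : Set V} (hX : X.Finite)
    (hdeg : ∀ a ∈ X, (H.neighborSet a).ncard = 2) {u p : V} (hu : u ∈ X) (hp : p ∉ X)
    (hup : H.Adj u p) (huniq : ∀ a ∈ X, ∀ b, b ∉ X → H.Adj a b → a = u ∧ b = p) : False := by
  classical
  have := hX.fintype
  have hcard : ∀ a : X, (H.induce X).degree a = (H.neighborSet a ∩ X).ncard := by
    intro a
    rw [← SimpleGraph.card_neighborSet_eq_degree, ← Nat.card_eq_fintype_card, Nat.card_coe_set_eq,
      ← Set.ncard_image_of_injective _ Subtype.val_injective]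
    congr 1
    ext b
    simp only [Set.mem_image, SimpleGraph.mem_neighborSet, SimpleGraph.comap_adj,
      Function.Embedding.subtype_apply, Subtype.exists, Set.mem_inter_iff]
    constructor
    · rintro ⟨b, hb, h, rfl⟩
      exact ⟨h, hb⟩
    · rintro ⟨h, hb⟩
      exact ⟨b, hb, h, rfl⟩
  have hodd : ∀ a : X, Odd ((H.induce X).degree a) ↔ a = ⟨u, hu⟩ := by
    intro a
    rw [hcard]
    constructor
    · intro h
      by_contra hne
      have : H.neighborSet a ∩ X = H.neighborSet a := by
        refine Set.inter_eq_left.2 fun b hb => ?_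
        by_contra hbX
        exact hne (Subtype.ext (huniq a a.2 b hbX hb).1)
      rw [this, hdeg a a.2] at h
      exact absurd h (by decide)
    · rintro rfl
      have : H.neighborSet u ∩ X = H.neighborSet u \ {p} := by
        ext b
        simp only [Set.mem_inter_iff, Set.mem_sdiff, Set.mem_singleton_iff]
        constructor
        · rintro ⟨h, hb⟩
          exact ⟨h, fun h => hp (h ▸ hb)⟩
        · rintro ⟨h, hb⟩
          refine ⟨h, ?_⟩
          by_contra hbX
          exact hb (huniq u hu b hbX h).2
      change Odd (H.neighborSet u ∩ X).ncard
      rw [this, Set.ncard_sdiff_singleton_of_mem (show p ∈ H.neighborSet u from hup), hdeg u hu]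
      decide
  have := (H.induce X).even_card_odd_degree_vertices
  simp only [hodd, Finset.filter_eq', Finset.mem_univ, if_true, Finset.card_singleton] at this
  exact absurd this (by decide)

section Cactus

variable {G : SimpleGraph V} {w : {s : Piece V // s.Admissible G} → V}
  {ref : ∀ s : {s : Piece V // s.Admissible G}, Refinement G s.1 (w s)}
  {s₀ : {s : Piece V // s.Admissible G}}

lemma Reach.core_adj {n : ℕ} {s : {s : Piece V // s.Admissible G}} (hs : Reach ref s₀ n s) {a b : V}
    (ha : a ∈ (ref s).C) (hb : b ∈ (ref s).C) (hab : (cactus ref s₀).Adj a b) :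
    (ref s).K.Adj a b := by
  have key : ∀ m t, Reach ref s₀ (m + 1) t → t.1.u ∈ (ref s).C → t.1.p ∉ (ref s).C := by
    intro m t ht hu
    obtain rfl := (hs.eq_of_mem_core ht hu (ref t).u_mem).2
    exact ht.p_not_mem
  rcases hab with ⟨m, t, ht, hab⟩ | ⟨m, t, ht, ⟨rfl, rfl⟩ | ⟨rfl, rfl⟩⟩
  · obtain rfl := (hs.eq_of_mem_core ht ha ((ref t).K_mem _ _ hab)).2
    exact hab
  · exact absurd hb (key m t ht ha)
  · exact absurd ha (key m t ht hb)

/-- An edge leaving a core joins the first terminal of the piece to its neighbor, or leads to a piece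
that comes later in the lexicographic order by level and rank. -/
lemma Reach.leaving_adj {n : ℕ} {s : {s : Piece V // s.Admissible G}} (hs : Reach ref s₀ n s)
    {a b : V} (ha : a ∈ (ref s).C) (hb : b ∉ (ref s).C) (hab : (cactus ref s₀).Adj a b) :
    a = s.1.u ∧ b = s.1.p ∨
      ∃ m t, Reach ref s₀ (m + 1) t ∧ b = t.1.u ∧ a = t.1.p ∧
        toLex (n, s.1.r) < toLex (m + 1, t.1.r) := by
  rcases hab with ⟨m, t, ht, hab⟩ | ⟨m, t, ht, ⟨rfl, rfl⟩ | ⟨rfl, rfl⟩⟩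
  · obtain rfl := (hs.eq_of_mem_core ht ha ((ref t).K_mem _ _ hab)).2
    exact absurd ((ref s).K_mem _ _ hab.symm) hb
  · obtain rfl := (hs.eq_of_mem_core ht ha (ref t).u_mem).2
    exact Or.inl ⟨rfl, rfl⟩
  · refine Or.inr ⟨m, t, ht, rfl, rfl, ?_⟩
    rw [Prod.Lex.toLex_lt_toLex]
    obtain ⟨q, hq, -, -, hp | ⟨q', hq', hp, hr⟩⟩ := ht.p_mem
    · obtain ⟨rfl, rfl⟩ := hs.eq_of_mem_core hq ha hp
      exact Or.inl (Nat.lt_succ_self _)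
    · obtain ⟨rfl, rfl⟩ := hs.eq_of_mem_core hq' ha hp
      exact Or.inr ⟨rfl, hr⟩

/-- Every cycle of the cactus is one of the cores. -/
lemma exists_core_of_isCycleSub (hcov : ∀ x, ∃ n s, Reach ref s₀ n s ∧ x ∈ (ref s).C)
    {O : (cactus ref s₀).Subgraph} (hO : IsCycleSub O) :
    ∃ n s, Reach ref s₀ n s ∧ O.verts = (ref s).C ∧ O.Adj = (ref s).K.Adj := by
  obtain ⟨hfin, hne, hconn, hdeg⟩ := hO
  choose lev st hst hmem using hcov
  obtain ⟨x, hx, hmax⟩ := hfin.exists_maximalFor (fun x => toLex (lev x, (st x).1.r)) _ hne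
  have hs := hst x
  set s := st x with hsdef
  have hexit : ∀ a ∈ (ref s).C, ∀ b, b ∉ (ref s).C → O.Adj a b → a = s.1.u ∧ b = s.1.p := by
    intro a ha b hb hab
    refine (hs.leaving_adj ha hb (O.adj_sub hab)).resolve_right ?_
    rintro ⟨m, t, ht, hbt, -, hlt⟩
    obtain ⟨h1, h2⟩ := (hst b).eq_of_mem_core ht (hmem _) (hbt ▸ (ref t).u_mem)
    rw [← h1, ← h2] at hlt
    exact hlt.not_ge (hmax (O.edge_vert hab.symm) hlt.le)
  have hclosed : ∀ a ∈ (ref s).C, ∀ b, O.Adj a b → b ∈ (ref s).C := by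
    intro a ha b hab
    by_contra hb
    obtain ⟨rfl, rfl⟩ := hexit a ha b hb hab
    refine false_of_unique_exit (H := O.spanningCoe) (X := (ref s).C ∩ O.verts)
      (hfin.subset Set.inter_subset_right) (fun a ha => hdeg a ha.2) ⟨ha, O.edge_vert hab⟩
      (fun h => hb h.1) hab fun a ha' b hb' hab' => ?_
    exact hexit a ha'.1 b (fun h => hb' ⟨h, O.edge_vert (O.symm.symm _ _ hab')⟩) hab'
  have hsub : O.verts ⊆ (ref s).C := by
    intro y hy
    have hr := hconn.coe.preconnected ⟨x, hx⟩ ⟨y, hy⟩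
    exact reachable_induction hr (fun z => (z : V) ∈ (ref s).C) (hmem x)
      fun a b hab ha => hclosed a ha b hab
  have hOK : ∀ a b, O.Adj a b → (ref s).K.Adj a b := fun a b hab =>
    hs.core_adj (hsub (O.edge_vert hab)) (hsub (O.edge_vert (O.symm.symm _ _ hab))) (O.adj_sub hab)
  have hKdeg : ∀ a ∈ (ref s).C, ((ref s).K.neighborSet a).ncard = 2 := by
    refine (ref s).K_deg.resolve_left fun hB => ?_
    obtain ⟨y, hy⟩ : (O.neighborSet x).Nonempty := by
      refine Set.nonempty_of_ncard_ne_zero ?_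
      rw [hdeg x hx]
      decide
    have h1 : ∀ z ∈ O.verts, z = s.1.u := fun z hz => by
      have := (ref s).C_sub (hsub hz)
      rwa [hB] at this
    exact (O.adj_sub hy).ne ((h1 x hx).trans (h1 y (O.edge_vert (O.symm.symm _ _ hy))).symm)
  have hnbr : ∀ a ∈ O.verts, O.neighborSet a = (ref s).K.neighborSet a := by
    intro a ha
    refine Set.eq_of_subset_of_ncard_le (fun b hb => hOK a b hb) ?_ ?_
    · rw [hdeg a ha, hKdeg a (hsub ha)]
    · refine Set.finite_of_ncard_ne_zero ?_
      rw [hKdeg a (hsub ha)]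
      decide
  have hverts : O.verts = (ref s).C := by
    refine hsub.antisymm fun y hy => ?_
    refine reachable_induction ((ref s).K_conn x (hmem x) y hy) (· ∈ O.verts) hx ?_
    intro a b hab ha
    have hb : b ∈ O.neighborSet a := by
      rw [hnbr a ha]
      exact hab
    exact O.edge_vert (O.symm.symm _ _ hb)
  refine ⟨_, s, hs, hverts, ?_⟩
  funext a b
  refine propext ⟨hOK a b, fun hab => ?_⟩
  have ha : a ∈ O.verts := hverts ▸ (ref s).K_mem a b hab
  have hb : b ∈ O.neighborSet a := by
    rw [hnbr a ha]
    exact hab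
  exact hb

lemma isCycleSub_core {n : ℕ} {s : {s : Piece V // s.Admissible G}} (hs : Reach ref s₀ n s)
    (hdeg : ∀ a ∈ (ref s).C, ((ref s).K.neighborSet a).ncard = 2) :
    ∃ O : (cactus ref s₀).Subgraph, IsCycleSub O ∧ O.verts = (ref s).C := by
  let O : (cactus ref s₀).Subgraph :=
    { verts := (ref s).C
      Adj := (ref s).K.Adj
      adj_sub := fun h => Or.inl ⟨n, s, hs, h⟩
      edge_vert := fun h => (ref s).K_mem _ _ h
      symm := ⟨fun _ _ h => (ref s).K.symm.symm _ _ h⟩ }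
  refine ⟨O, ⟨(ref s).C_fin, ⟨_, (ref s).u_mem⟩, ⟨?_⟩, hdeg⟩, rfl⟩
  have : Nonempty O.verts := ⟨⟨_, (ref s).u_mem⟩⟩
  refine ⟨?_⟩
  rintro ⟨a, ha⟩ ⟨b, hb⟩
  have key : ∃ hb : b ∈ (ref s).C, O.coe.Reachable ⟨a, ha⟩ ⟨b, hb⟩ :=
    reachable_induction ((ref s).K_conn a ha b hb)
      (fun y => ∃ hy : y ∈ (ref s).C, O.coe.Reachable ⟨a, ha⟩ ⟨y, hy⟩) ⟨ha, .rfl⟩ (by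
        rintro x y hxy ⟨hx, hr⟩
        have hy := (ref s).K_mem _ _ hxy.symm
        have hadj : O.coe.Adj ⟨x, hx⟩ ⟨y, hy⟩ := hxy
        exact ⟨hy, hr.trans hadj.reachable⟩)
  exact key.2

lemma cactus_connected (hcov : ∀ x, ∃ n s, Reach ref s₀ n s ∧ x ∈ (ref s).C)
    (huniv : s₀.1.B = Set.univ) : (cactus ref s₀).Connected := by
  have : Nonempty V := ⟨s₀.1.u⟩
  refine ⟨fun a b => ?_⟩
  have h : ∀ x, (cactus ref s₀).Reachable x s₀.1.u := fun x =>
    (cactus_reachable_u hcov .root (huniv ▸ Set.mem_univ x)).mono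
      (show restr (cactus ref s₀) s₀.1.B ≤ cactus ref s₀ from fun _ _ h => h.1)
  exact (h a).trans (h b).symm

lemma isCactus_cactus (hG : Subcubic G)
    (hcov : ∀ x, ∃ n s, Reach ref s₀ n s ∧ x ∈ (ref s).C) (huniv : s₀.1.B = Set.univ) :
    IsCactus (cactus ref s₀) := by
  refine ⟨cactus_connected hcov huniv, fun x => ?_, fun O₁ O₂ h₁ h₂ hne => ?_, fun x hx => ?_⟩
  · have hss : (cactus ref s₀).neighborSet x ⊆ G.neighborSet x := fun _ h => cactus_le h
    exact ⟨(hG x).1.subset hss, (Set.ncard_le_ncard hss (hG x).1).trans (hG x).2⟩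
  · rw [Set.disjoint_left]
    intro x hx₁ hx₂
    obtain ⟨n, s, hs, hv₁, ha₁⟩ := exists_core_of_isCycleSub hcov h₁
    obtain ⟨m, t, ht, hv₂, ha₂⟩ := exists_core_of_isCycleSub hcov h₂
    obtain rfl := (hs.eq_of_mem_core ht (hv₁ ▸ hx₁) (hv₂ ▸ hx₂)).2
    exact hne (SimpleGraph.Subgraph.ext (hv₁.trans hv₂.symm) (ha₁.trans ha₂.symm))
  · obtain ⟨n, s, hs, hxs⟩ := hcov x
    have hB : s.1.B = {s.1.u} := by
      refine (ref s).K_deg.resolve_right fun hdeg => ?_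
      obtain ⟨O, hO, hOv⟩ := isCycleSub_core hs hdeg
      exact hx O hO (hOv ▸ hxs)
    have hBC : s.1.B ⊆ (ref s).C := by
      rw [hB, Set.singleton_subset_iff]
      exact (ref s).u_mem
    have hnbr : ∀ y, (cactus ref s₀).Adj x y → y = s.1.p ∨
        ∃ m t, Reach ref s₀ (m + 1) t ∧ y = t.1.u ∧ x = t.1.p := by
      intro y hxy
      by_cases hy : y ∈ (ref s).C
      · have h1 : ∀ z ∈ (ref s).C, z = s.1.u := fun z hz => by
          have := (ref s).C_sub hz
          rwa [hB] at this
        exact absurd ((h1 x hxs).trans (h1 y hy).symm) hxy.ne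
      · rcases hs.leaving_adj hxs hy hxy with h | ⟨m, t, ht, hyt, hxt, -⟩
        · exact Or.inl h.2
        · exact Or.inr ⟨m, t, ht, hyt, hxt⟩
    by_cases hex : ∃ m t, Reach ref s₀ (m + 1) t ∧ x = t.1.p
    · obtain ⟨m, t, ht, rfl⟩ := hex
      refine (Set.ncard_le_ncard (t := {s.1.p, t.1.u}) ?_ (Set.toFinite _)).trans
        ((Set.ncard_insert_le _ _).trans (by simp))
      intro y hy
      refine (hnbr y hy).imp id ?_
      rintro ⟨k, q, hq, rfl, hp⟩
      rw [hs.eq_of_p_eq hBC ht hq hxs hp]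
      rfl
    · refine (Set.ncard_le_ncard (t := {s.1.p}) ?_ (Set.toFinite _)).trans (by simp)
      intro y hy
      rcases hnbr y hy with h | ⟨m, t, ht, -, h⟩
      · exact h
      · exact absurd ⟨m, t, ht, h⟩ hex

end Cactus

section Faithful

variable {G F : SimpleGraph V}

lemma del_mono (hFG : F ≤ G) {S T : Set V} (hST : S ⊆ T) : del F T ≤ del G S := fun _ _ h =>
  ⟨hFG h.1, fun h' => h.2.1 (hST h'), fun h' => h.2.2 (hST h')⟩

lemma RayEquiv.mono (hFG : F ≤ G) {R₁ R₂ : ℕ → V} (h : RayEquiv F R₁ R₂) : RayEquiv G R₁ R₂ := by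
  intro S hS
  obtain ⟨m, n, hm, hn, hr⟩ := h S hS
  exact ⟨m, n, hm, hn, hr.mono (del_mono hFG subset_rfl)⟩

lemma exists_adj_toward (hF : F.Connected) {o x z : V} (hxz : x ≠ z)
    (hd : F.dist o z = F.dist o x + F.dist x z) :
    ∃ y, F.Adj x y ∧ F.dist o y = F.dist o x + 1 ∧ F.dist o z = F.dist o y + F.dist y z := by
  obtain ⟨p, hp⟩ := hF.exists_walk_length_eq_dist x z
  cases p with
  | nil => exact absurd rfl hxz
  | @cons _ y _ h q =>
    rw [SimpleGraph.Walk.length_cons] at hp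
    have e1 : F.dist y z ≤ q.length := SimpleGraph.dist_le q
    have e2 : F.dist o z ≤ F.dist o y + F.dist y z := hF.dist_triangle
    have e3 : F.dist o y ≤ F.dist o x + F.dist x y := hF.dist_triangle
    rw [SimpleGraph.dist_eq_one_iff_adj.2 h] at e3
    exact ⟨y, h, by omega, by omega⟩

/-- In a connected locally finite spanning subgraph `F`, every end of `G` contains a ray of `F`. -/
lemma exists_ray (hF : F.Connected) (hfin : LocFin F) {R : ℕ → V} (hR : Function.Injective R) :
    ∃ R' : ℕ → V, IsRay F R' ∧ RayEquiv F R R' := by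
  obtain ⟨o⟩ := hF.nonempty
  let I : V → Set ℕ := fun x => {i | F.dist o (R i) = F.dist o x + F.dist x (R i)}
  have hstep : ∀ x : {x // (I x).Infinite}, ∃ y : {x // (I x).Infinite},
      F.Adj x.1 y.1 ∧ F.dist o y.1 = F.dist o x.1 + 1 := by
    rintro ⟨x, hx⟩
    by_contra! hc
    refine hx ?_
    have hsub : I x ⊆ R ⁻¹' {x} ∪
        ⋃ y ∈ F.neighborSet x, {i | i ∈ I y ∧ F.dist o y = F.dist o x + 1} := by
      intro i hi
      by_cases hxi : x = R i
      · exact Or.inl hxi.symm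
      · obtain ⟨y, hxy, hy, hi'⟩ := exists_adj_toward hF hxi hi
        exact Or.inr (Set.mem_biUnion hxy ⟨hi', hy⟩)
    refine Set.Finite.subset (Set.Finite.union ((Set.finite_singleton x).preimage hR.injOn)
      ((hfin x).biUnion fun y hxy => ?_)) hsub
    by_cases hy : F.dist o y = F.dist o x + 1
    · refine Set.Finite.subset ?_ (fun i hi => hi.1 : _ ⊆ I y)
      by_contra hinf
      exact hc ⟨y, hinf⟩ hxy hy
    · simp [hy]
  have hroot : (I o).Infinite := by
    have : I o = Set.univ := by
      ext i
      simp [I]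
    rw [this]
    exact Set.infinite_univ
  choose nxt hnxt using hstep
  let X : ℕ → {x // (I x).Infinite} := fun n => nxt^[n] ⟨o, hroot⟩
  have hX : ∀ n, X (n + 1) = nxt (X n) := fun n => Function.iterate_succ_apply' nxt n _
  have hdist : ∀ n, F.dist o (X n).1 = n := by
    intro n
    induction n with
    | zero => simp [X]
    | succ n ih => rw [hX, (hnxt (X n)).2, ih]
  refine ⟨fun n => (X n).1, ⟨fun m n h => ?_, fun n => ?_⟩, fun S hS => ?_⟩
  · rw [← hdist m, ← hdist n]
    exact congrArg (F.dist o) h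
  · change F.Adj (X n).1 (X (n + 1)).1
    rw [hX]
    exact (hnxt (X n)).1
  · obtain ⟨m, hm⟩ : ∃ m, ∀ y ∈ S, F.dist o y < m := by
      obtain ⟨M, hM⟩ := (hS.image (F.dist o)).bddAbove
      exact ⟨M + 1, fun y hy => Nat.lt_succ_of_le (hM ⟨y, hy, rfl⟩)⟩
    obtain ⟨k, hk⟩ : ∃ k, ∀ j, k ≤ j → R j ∉ S := by
      obtain ⟨M, hM⟩ := (hS.preimage hR.injOn).bddAbove
      refine ⟨M + 1, fun j hj hjS => ?_⟩
      have := hM hjS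
      omega
    obtain ⟨j, hj, hkj⟩ := (X m).2.exists_gt k
    refine ⟨j, m, fun i hi => hk i (by omega), fun i hi hiS => ?_, ?_⟩
    · have := hm _ hiS
      rw [hdist] at this
      omega
    · have key : ∀ l x, F.dist x (R j) = l → m ≤ F.dist o x →
          F.dist o (R j) = F.dist o x + F.dist x (R j) → (del F S).Reachable x (R j) := by
        intro l
        induction l with
        | zero =>
          intro x hx _ _
          rw [hF.dist_eq_zero_iff.1 hx]
        | succ l ih =>
          intro x hx hmx hd
          have hne : x ≠ R j := by
            rintro rfl
            simp at hx
          obtain ⟨y, hxy, hy, hd'⟩ := exists_adj_toward hF hne hd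
          have hadj : (del F S).Adj x y :=
            ⟨hxy, fun h => (hm x h).not_ge hmx, fun h => (hm y h).not_ge (by omega)⟩
          exact hadj.reachable.trans (ih y (by omega) (by omega) hd')
      exact (key _ _ rfl (hdist m).ge hj).symm

end Faithful

section CactusFaithful

variable {G : SimpleGraph V} {w : {s : Piece V // s.Admissible G} → V}
  {ref : ∀ s : {s : Piece V // s.Admissible G}, Refinement G s.1 (w s)}
  {s₀ : {s : Piece V // s.Admissible G}}

lemma cactus_reachable_of_disjoint (hcov : ∀ x, ∃ n s, Reach ref s₀ n s ∧ x ∈ (ref s).C) {n : ℕ}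
    {s : {s : Piece V // s.Admissible G}} (hs : Reach ref s₀ n s) {S : Set V}
    (hS : Disjoint s.1.B S) {a b : V} (ha : a ∈ s.1.B) (hb : b ∈ s.1.B) :
    (del (cactus ref s₀) S).Reachable a b := by
  have hle : restr (cactus ref s₀) s.1.B ≤ del (cactus ref s₀) S := fun x y h =>
    ⟨h.1, Set.disjoint_left.1 hS h.2.1, Set.disjoint_left.1 hS h.2.2⟩
  exact ((cactus_reachable_u hcov hs ha).trans (cactus_reachable_u hcov hs hb).symm).mono hle

lemma exists_finite_separator (hcov : ∀ x, ∃ n s, Reach ref s₀ n s ∧ x ∈ (ref s).C) {S : Set V}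
    (hS : S.Finite) (k : ℕ) : ∀ n s, Reach ref s₀ n s →
      (∀ t, Reach ref s₀ (n + k) t → Disjoint t.1.B S) →
      ∃ T : Set V, T.Finite ∧ ∀ a ∈ s.1.B, a ∉ T → ∀ b, (del (restr G s.1.B) T).Reachable a b →
        (del (cactus ref s₀) S).Reachable a b := by
  induction k with
  | zero =>
    intro n s hs hdisj
    refine ⟨∅, Set.finite_empty, fun a ha _ b hab => ?_⟩
    refine cactus_reachable_of_disjoint hcov hs (hdisj s hs) ha ?_
    exact reachable_induction hab (· ∈ s.1.B) ha fun x y h _ => h.1.2.2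
  | succ k ih =>
    intro n s hs hdisj
    have hch : ∀ x, ∃ T : Set V, T.Finite ∧ (x ∈ s.1.B \ (ref s).C → ∀ a ∈ ((ref s).ch x).B,
        a ∉ T → ∀ b, (del (restr G ((ref s).ch x).B) T).Reachable a b →
        (del (cactus ref s₀) S).Reachable a b) := by
      intro x
      by_cases hx : x ∈ s.1.B \ (ref s).C
      · obtain ⟨T, hT, h⟩ := ih (n + 1) _ (hs.step hx) fun t ht => hdisj t (by
          rwa [show n + (k + 1) = n + 1 + k by omega])
        exact ⟨T, hT, fun _ => h⟩
      · exact ⟨∅, Set.finite_empty, fun h => absurd h hx⟩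
    choose T hTf hT using hch
    refine ⟨(ref s).T ∪ ⋃ x ∈ S, T x, (ref s).T_fin.union (hS.biUnion fun x _ => hTf x), ?_⟩
    intro a ha haT b hab
    set T' := (ref s).T ∪ ⋃ x ∈ S, T x with hT'
    have hnot : ∀ y, y ∉ T' → y ∉ (ref s).C := fun y hy h => hy (Or.inl ((ref s).C_sub_T h))
    have haY : a ∈ s.1.B \ (ref s).C := ⟨ha, hnot a haT⟩
    have hstep : b ∈ ((ref s).ch a).B ∧
        (del (restr G ((ref s).ch a).B) T').Reachable a b := by
      refine reachable_induction hab (fun y => y ∈ ((ref s).ch a).B ∧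
        (del (restr G ((ref s).ch a).B) T').Reachable a y) ⟨(ref s).ch_mem a haY, .rfl⟩ ?_
      rintro x y ⟨⟨hxy, hx, hy⟩, hxT, hyT⟩ ⟨hxa, hr⟩
      have hya : y ∈ ((ref s).ch a).B := by
        rw [← (ref s).ch_eq a haY x hxa, (ref s).T_sep x hx y hy (fun h => hxT (Or.inl h))
          (fun h => hyT (Or.inl h)) hxy]
        exact (ref s).ch_mem y ⟨hy, hnot y hyT⟩
      have hadj : (del (restr G ((ref s).ch a).B) T').Adj x y := ⟨⟨hxy, hxa, hya⟩, hxT, hyT⟩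
      exact ⟨hya, hr.trans hadj.reachable⟩
    by_cases hdis : Disjoint ((ref s).ch a).B S
    · exact cactus_reachable_of_disjoint hcov (hs.step haY) hdis ((ref s).ch_mem a haY) hstep.1
    · obtain ⟨x, hxa, hxS⟩ := Set.not_disjoint_iff.1 hdis
      have hxe := (ref s).ch_eq a haY x hxa
      have hxT : T x ⊆ T' := fun y hy => Or.inr (Set.mem_biUnion hxS hy)
      refine hT x ((ref s).ch_sub a haY hxa) a (hxe ▸ (ref s).ch_mem a haY)
        (fun h => haT (hxT h)) b ?_
      rw [hxe]
      exact hstep.2.mono (del_mono le_rfl hxT)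

lemma rayEquiv_cactus (hcov : ∀ x, ∃ n s, Reach ref s₀ n s ∧ x ∈ (ref s).C)
    (huniv : s₀.1.B = Set.univ) {R₁ R₂ : ℕ → V} (h : RayEquiv G R₁ R₂) :
    RayEquiv (cactus ref s₀) R₁ R₂ := by
  intro S hS
  obtain ⟨k, hk⟩ : ∃ k, ∀ t, Reach ref s₀ (0 + k) t → Disjoint t.1.B S := by
    choose lev st hst hmem using hcov
    obtain ⟨M, hM⟩ := (hS.image lev).bddAbove
    refine ⟨M + 1, fun t ht => Set.disjoint_left.2 fun x hxt hxS => ?_⟩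
    have h1 := (hst x).le_of_mem ht (hmem x) hxt
    have h2 := hM ⟨x, hxS, rfl⟩
    omega
  obtain ⟨T, hT, hsep⟩ := exists_finite_separator hcov hS k 0 s₀ .root hk
  obtain ⟨m, n, hm, hn, hr⟩ := h (S ∪ T) (hS.union hT)
  refine ⟨m, n, fun i hi h => hm i hi (Or.inl h), fun i hi h => hn i hi (Or.inl h), ?_⟩
  have huniv' : ∀ x, x ∈ s₀.1.B := fun x => huniv ▸ Set.mem_univ x
  refine hsep _ (huniv' _) (fun h => hm m le_rfl (Or.inr h)) _ (hr.mono fun x y h => ?_)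
  exact ⟨⟨h.1, huniv' x, huniv' y⟩, fun h' => h.2.1 (Or.inr h'), fun h' => h.2.2 (Or.inr h')⟩

lemma faithful_cactus (hG : Subcubic G)
    (hcov : ∀ x, ∃ n s, Reach ref s₀ n s ∧ x ∈ (ref s).C) (huniv : s₀.1.B = Set.univ) :
    Faithful (cactus ref s₀) G := by
  refine ⟨fun R hR => ?_, fun R₁ R₂ _ _ =>
    ⟨fun h => h.mono cactus_le, fun h => rayEquiv_cactus hcov huniv h⟩⟩
  obtain ⟨R', hR', h⟩ := exists_ray (cactus_connected hcov huniv)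
    (fun x => ((hG x).1.subset fun _ h => cactus_le h)) hR.1
  exact ⟨R', hR', h.mono cactus_le⟩

end CactusFaithful

lemma countable_of_connected_of_locFin {G : SimpleGraph V} (hG : G.Connected) (hfin : LocFin G) :
    Countable V := by
  obtain ⟨o⟩ := hG.nonempty
  have key : ∀ n : ℕ, {x | G.dist o x = n}.Finite := by
    intro n
    induction n with
    | zero =>
      refine (Set.finite_singleton o).subset fun x hx => ?_
      exact (hG.dist_eq_zero_iff.1 hx).symm
    | succ n ih =>
      refine (ih.biUnion fun y _ => hfin y).subset fun x hx => ?_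
      obtain ⟨p, hp⟩ := hG.exists_walk_length_eq_dist x o
      rw [SimpleGraph.dist_comm, show G.dist o x = n + 1 from hx] at hp
      cases p with
      | nil => simp at hp
      | @cons _ y _ h q =>
        rw [SimpleGraph.Walk.length_cons] at hp
        have e1 : G.dist y o ≤ q.length := SimpleGraph.dist_le q
        have e2 : G.dist o x ≤ G.dist o y + G.dist y x := hG.dist_triangle
        rw [SimpleGraph.dist_eq_one_iff_adj.2 h.symm, show G.dist o x = n + 1 from hx] at e2
        rw [SimpleGraph.dist_comm] at e1
        exact Set.mem_biUnion (show G.dist o y = n by omega) h.symm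
  rw [← Set.countable_univ_iff]
  refine (Set.countable_iUnion fun n => (key n).countable).mono fun x _ => ?_
  exact Set.mem_iUnion.2 ⟨_, rfl⟩

lemma IsKConn.reachable_deleteEdges {G : SimpleGraph V} (h : IsKConn 2 G) {a b c : V}
    (hba : b ≠ a) (hca : c ≠ a) : (G.deleteEdges {s(a, b)}).Reachable b c := by
  have hconn := h.2 {a} (Set.finite_singleton a) (by simp)
  refine (hconn.preconnected ⟨b, hba⟩ ⟨c, hca⟩).map ⟨Subtype.val, ?_⟩
  rintro ⟨x, hx⟩ ⟨y, hy⟩ hxy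
  rw [SimpleGraph.deleteEdges_adj]
  refine ⟨hxy, fun he => ?_⟩
  simp only [Set.mem_singleton_iff, Sym2.eq_iff] at he
  rcases he with ⟨h1, -⟩ | ⟨-, h1⟩
  · exact hx h1
  · exact hy h1

lemma IsKConn.connected {G : SimpleGraph V} (h : IsKConn 2 G) : G.Connected := by
  have hconn := h.2 ∅ Set.finite_empty (by simp)
  obtain ⟨o⟩ := hconn.nonempty
  have : Nonempty V := ⟨o.1⟩
  refine ⟨fun a b => ?_⟩
  exact (hconn.preconnected ⟨a, fun h => h⟩ ⟨b, fun h => h⟩).map ⟨Subtype.val, fun h => h⟩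

lemma IsKConn.twoEdgeConnOn_univ {G : SimpleGraph V} [Infinite V] (h : IsKConn 2 G) :
    TwoEdgeConnOn G Set.univ := by
  have hG : restr G Set.univ = G := by
    ext a b
    simp [restr]
  rw [TwoEdgeConnOn, hG]
  refine ⟨fun a _ b _ => h.connected.preconnected a b, fun a b hab => ?_⟩
  obtain ⟨c, hc⟩ := (Set.toFinite {a, b}).exists_notMem
  simp only [Set.mem_insert_iff, Set.mem_singleton_iff, not_or] at hc
  have h1 := h.reachable_deleteEdges hab.ne' hc.1
  have h2 := h.reachable_deleteEdges hab.ne hc.2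
  rw [Sym2.eq_swap] at h2
  exact h2.trans h1.symm

/-- Every infinite 2-connected subcubic graph has a faithful spanning
cactus. -/
theorem exists_faithful_spanning_cactus {V : Type u} (G : SimpleGraph V)
    (hinf : Infinite V) (h2 : IsKConn 2 G) (hsc : Subcubic G) :
    ∃ F : SimpleGraph V, F ≤ G ∧ IsCactus F ∧ Faithful F G := by
  have hconn := h2.connected
  have := countable_of_connected_of_locFin hconn fun x => (hsc x).1
  obtain ⟨idx, hidx⟩ := exists_injective_nat V
  obtain ⟨o⟩ := hconn.nonempty
  have hmin : ∀ s : {s : Piece V // s.Admissible G},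
      ∃ w, w ∈ s.1.B ∧ ∀ y ∈ s.1.B, idx w ≤ idx y := fun s =>
    ⟨Function.argminOn idx s.1.B ⟨_, s.2.u_mem⟩, Function.argminOn_mem idx s.1.B _,
      fun _ hy => Function.argminOn_le idx s.1.B hy⟩
  choose w hw using hmin
  let ref : ∀ s : {s : Piece V // s.Admissible G}, Refinement G s.1 (w s) := fun s =>
    (exists_refinement hsc s.2 (hw s).1).some
  let s₀ : {s : Piece V // s.Admissible G} :=
    ⟨⟨Set.univ, o, o, o, 0⟩, h2.twoEdgeConnOn_univ, Set.mem_univ _, Set.mem_univ _⟩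
  have hcov : ∀ x, ∃ n s, Reach ref s₀ n s ∧ x ∈ (ref s).C := fun x =>
    exists_mem_core hidx hw (Set.mem_univ x)
  exact ⟨cactus ref s₀, cactus_le, isCactus_cactus hsc hcov rfl, faithful_cactus hsc hcov rfl⟩

end IGraph
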